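/- arXiv:1209.0081 — 8 statements merged into one kernel-verified Lean document; each statement's English description precedes it below -/
import Mathlib

section
/- Let K be a complete nonarchimedean normed field with ‖(p : K)‖ = (p : ℝ)⁻¹ for a prime p. Let a : ℕ → K be such that for every x ∈ K with ‖x‖ < 1 the series Σ_{n≥0} aₙ xⁿ is summable, and define f(x) = Σ'_{n≥0} aₙ xⁿ. Assume the 'étale' coefficient condition: for every real ρ with 0 < ρ < 1 and every integer n ≥ 2, ‖a₁‖ > ‖(n : K) · aₙ‖ · ρ^{n-1}. Then f is injective on every open disk of radius p^{-1/(p-1)} contained in the open unit disk; concretely, for all x, y ∈ K with ‖x‖ < 1, ‖y‖ < 1 and ‖x − y‖ < (p : ℝ)^{-1/(p-1)} (real exponent), f(x) = f(y) implies x = y. -/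
section Ultrametric

variable {K : Type*} [NormedField K] [IsUltrametricDist K]

theorem norm_sum_lt_of_forall_norm_lt {ι : Type*} {g : ι → K} {s : Finset ι} {C : ℝ}
    (hC : 0 < C) (hg : ∀ i ∈ s, ‖g i‖ < C) : ‖∑ i ∈ s, g i‖ < C :=
  Finset.sum_induction g (fun z => ‖z‖ < C)
    (fun _ _ hu hv => (IsUltrametricDist.norm_add_le_max _ _).trans_lt (max_lt hu hv))
    (by simpa using hC) hg

/-- In an ultrametric field, a strict bound on the terms of a convergent series passes to
its sum, since open balls are closed. -/
theorem HasSum.norm_lt_of_forall_norm_lt {ι : Type*} {g : ι → K} {s : K} {C : ℝ}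
    (hs : HasSum g s) (hC : 0 < C) (hg : ∀ i, ‖g i‖ < C) : ‖s‖ < C := by
  have hmem : s ∈ Metric.ball (0 : K) C :=
    (IsUltrametricDist.isClosed_ball (0 : K) C).mem_of_tendsto hs <| .of_forall fun t => by
      simpa using norm_sum_lt_of_forall_norm_lt (s := t) hC fun i _ => hg i
  simpa using hmem

theorem norm_natCast_eq_one_of_coprime {p m : ℕ} (hp : ‖(p : K)‖ < 1) (hm : p.Coprime m) :
    ‖(m : K)‖ = 1 := by
  refine le_antisymm (IsUltrametricDist.norm_natCast_le_one K m) (not_lt.mp fun hlt => ?_)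
  obtain ⟨u, v, huv⟩ := Nat.isCoprime_iff_coprime.mpr hm
  have hK : (u : K) * p + v * m = 1 := by exact_mod_cast congrArg (Int.cast : ℤ → K) huv
  have hint (w : ℤ) {z : K} (hz : ‖z‖ < 1) : ‖(w : K) * z‖ < 1 := by
    rw [norm_mul]
    exact (mul_le_of_le_one_left (norm_nonneg _)
      (IsUltrametricDist.norm_intCast_le_one K w)).trans_lt hz
  have := (IsUltrametricDist.norm_add_le_max _ _).trans_lt (max_lt (hint u hp) (hint v hlt))
  simp [hK] at this

theorem norm_pow_lt_norm_natCast {p : ℕ} (hp : p.Prime) (hpK : ‖(p : K)‖ = (p : ℝ)⁻¹)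
    {h : K} (hh : ‖h‖ < (p : ℝ) ^ (-1 / ((p : ℝ) - 1))) {j : ℕ} (hj : j ≠ 0) :
    ‖h‖ ^ j < ‖((j + 1 : ℕ) : K)‖ := by
  have hp1 : (1 : ℝ) < p := by exact_mod_cast hp.one_lt
  have hp0 : (0 : ℝ) < p := by linarith
  obtain ⟨v, m, hm, hk⟩ :=
    Nat.exists_eq_pow_mul_and_not_dvd (Nat.succ_ne_zero j) p hp.ne_one
  have hnorm : ‖((j + 1 : ℕ) : K)‖ = (p : ℝ) ^ (-(v : ℝ)) := by
    rw [show j + 1 = p ^ v * m from hk, Nat.cast_mul, Nat.cast_pow, norm_mul, norm_pow, hpK,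
      norm_natCast_eq_one_of_coprime (hpK ▸ inv_lt_one_of_one_lt₀ hp1)
        ((Nat.Prime.coprime_iff_not_dvd hp).mpr hm), mul_one, Real.rpow_neg hp0.le,
      Real.rpow_natCast, inv_pow]
  have hbern : (v : ℝ) * (p - 1) ≤ j := by
    have h1 : 1 + (v : ℝ) * (p - 1) ≤ (1 + (p - 1)) ^ v :=
      one_add_mul_le_pow (by linarith) v
    have h2 : p ^ v ≤ j + 1 :=
      (Nat.le_mul_of_pos_right _ (Nat.pos_of_ne_zero (by rintro rfl; simp at hm))).trans_eq
        hk.symm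
    have h3 : (p : ℝ) ^ v ≤ j + 1 := by exact_mod_cast h2
    rw [add_sub_cancel] at h1
    linarith
  calc ‖h‖ ^ j < ((p : ℝ) ^ (-1 / ((p : ℝ) - 1))) ^ j :=
        pow_lt_pow_left₀ hh (norm_nonneg _) hj
    _ = (p : ℝ) ^ (-1 / ((p : ℝ) - 1) * j) := by
        rw [← Real.rpow_natCast, ← Real.rpow_mul hp0.le]
    _ ≤ (p : ℝ) ^ (-(v : ℝ)) := by
        refine Real.rpow_le_rpow_of_exponent_le hp1.le ?_
        rw [div_mul_eq_mul_div, div_le_iff₀ (by linarith)]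
        linarith
    _ = _ := hnorm.symm

/-- The terms of the Taylor expansion of `c * X ^ (m + 1)` at `y`, other than the constant one,
are dominated by the increment `h`. -/
theorem norm_mul_pow_mul_choose_lt {p : ℕ} (hp : p.Prime) (hpK : ‖(p : K)‖ = (p : ℝ)⁻¹)
    {A : ℝ} (hA : 0 < A) {c h y : K} {m : ℕ} (hle : ‖((m + 1 : ℕ) : K) * c‖ ≤ A)
    (hlt : ‖((m + 1 : ℕ) : K) * c‖ * ‖y‖ ^ m < A) (hy : ‖y‖ ≤ 1) (h0 : h ≠ 0)
    (hh : ‖h‖ < (p : ℝ) ^ (-1 / ((p : ℝ) - 1))) (j : ℕ) :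
    ‖c * (h ^ (j + 1) * y ^ (m - j) * ((m + 1).choose (j + 1) : K))‖ < A * ‖h‖ := by
  have hpos : 0 < ‖h‖ := norm_pos_iff.mpr h0
  rcases eq_or_ne j 0 with rfl | hj
  · have := mul_lt_mul_of_pos_right hlt hpos
    simp only [norm_mul, norm_pow, zero_add, Nat.choose_one_right, pow_one, Nat.sub_zero]
      at this ⊢
    linarith
  · have hk := norm_pow_lt_norm_natCast hp hpK hh hj
    have hkpos : 0 < ‖((j + 1 : ℕ) : K)‖ := (pow_pos hpos j).trans hk
    refine lt_of_mul_lt_mul_right ?_ hkpos.le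
    have hchoose : ((m + 1 : ℕ) : K) * (m.choose j : K) =
        ((m + 1).choose (j + 1) : K) * ((j + 1 : ℕ) : K) := by
      exact_mod_cast congrArg (Nat.cast : ℕ → K) (Nat.add_one_mul_choose_eq m j)
    have hrest : ‖y ^ (m - j) * (m.choose j : K)‖ ≤ 1 := by
      rw [norm_mul, norm_pow]
      exact mul_le_one₀ (pow_le_one₀ (norm_nonneg _) hy) (norm_nonneg _)
        (IsUltrametricDist.norm_natCast_le_one K _)
    calc ‖c * (h ^ (j + 1) * y ^ (m - j) * ((m + 1).choose (j + 1) : K))‖ *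
          ‖((j + 1 : ℕ) : K)‖
        = ‖((m + 1 : ℕ) : K) * c‖ * ‖y ^ (m - j) * (m.choose j : K)‖ *
            (‖h‖ ^ j * ‖h‖) := by
          rw [← pow_succ, ← norm_pow]
          simp only [← norm_mul]
          congr 1
          linear_combination (-(c * h ^ (j + 1) * y ^ (m - j))) * hchoose
      _ ≤ A * 1 * (‖h‖ ^ j * ‖h‖) := by gcongr
      _ < A * ‖h‖ * ‖((j + 1 : ℕ) : K)‖ := by
          have := mul_lt_mul_of_pos_left hk (mul_pos hA hpos)
          linarith

theorem norm_mul_pow_sub_pow_lt {p : ℕ} (hp : p.Prime) (hpK : ‖(p : K)‖ = (p : ℝ)⁻¹)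
    {A : ℝ} (hA : 0 < A) {c x y : K} {m : ℕ} (hle : ‖((m + 1 : ℕ) : K) * c‖ ≤ A)
    (hlt : ‖((m + 1 : ℕ) : K) * c‖ * ‖y‖ ^ m < A) (hy : ‖y‖ ≤ 1) (hne : x ≠ y)
    (hxy : ‖x - y‖ < (p : ℝ) ^ (-1 / ((p : ℝ) - 1))) :
    ‖c * x ^ (m + 1) - c * y ^ (m + 1)‖ < A * ‖x - y‖ := by
  have hsub : x - y ≠ 0 := sub_ne_zero.mpr hne
  have hexp : c * x ^ (m + 1) - c * y ^ (m + 1) = ∑ j ∈ Finset.range (m + 1),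
      c * ((x - y) ^ (j + 1) * y ^ (m - j) * ((m + 1).choose (j + 1) : K)) := by
    nth_rewrite 1 [← sub_add_cancel x y]
    rw [add_pow, Finset.sum_range_succ', ← Finset.mul_sum]
    simp [mul_add]
  rw [hexp]
  exact norm_sum_lt_of_forall_norm_lt (mul_pos hA (norm_pos_iff.mpr hsub)) fun j _ =>
    norm_mul_pow_mul_choose_lt hp hpK hA hle hlt hy hsub hxy j

end Ultrametric

/-- **p-adic Rolle theorem (Robert–Berkovich), power-series form.**
If the coefficients of `f(x) = ∑ aₙ xⁿ` satisfy Berkovich's étale condition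
`‖a₁‖ > ‖n·aₙ‖·ρ^(n-1)` for all `0 < ρ < 1` and `n ≥ 2`, then `f` is injective on
every open disk of radius `p^(-1/(p-1))` contained in the open unit disk. -/
theorem stmt_0 {K : Type*} [NormedField K] [IsUltrametricDist K] [CompleteSpace K]
    (p : ℕ) (hp : p.Prime) (hpK : ‖(p : K)‖ = (p : ℝ)⁻¹)
    (a : ℕ → K)
    (hconv : ∀ x : K, ‖x‖ < 1 → Summable (fun n : ℕ => a n * x ^ n))
    (f : K → K) (hf : ∀ x : K, f x = ∑' n : ℕ, a n * x ^ n)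
    (hetale : ∀ ρ : ℝ, 0 < ρ → ρ < 1 → ∀ n : ℕ, 2 ≤ n →
      ‖a 1‖ > ‖(n : K) * a n‖ * ρ ^ (n - 1))
    (x y : K) (hx : ‖x‖ < 1) (hy : ‖y‖ < 1)
    (hxy : ‖x - y‖ < (p : ℝ) ^ (-1 / ((p : ℝ) - 1)))
    (heq : f x = f y) : x = y := by
  by_contra hne
  have hA : 0 < ‖a 1‖ :=
    (by positivity : (0 : ℝ) ≤ _).trans_lt (hetale (1 / 2) (by norm_num) (by norm_num) 2 le_rfl)
  have hC : 0 < ‖a 1‖ * ‖x - y‖ := mul_pos hA (norm_pos_iff.mpr (sub_ne_zero.mpr hne))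
  have hle (n : ℕ) (hn : 2 ≤ n) : ‖(n : K) * a n‖ ≤ ‖a 1‖ := by
    have hlim : Filter.Tendsto (fun ρ : ℝ => ‖(n : K) * a n‖ * ρ ^ (n - 1))
        (nhdsWithin 1 (Set.Iio 1)) (nhds (‖(n : K) * a n‖ * 1 ^ (n - 1))) :=
      (Continuous.tendsto (by fun_prop) 1).mono_left nhdsWithin_le_nhds
    rw [one_pow, mul_one] at hlim
    refine le_of_tendsto hlim ?_
    filter_upwards [Ioo_mem_nhdsLT (zero_lt_one' ℝ)] with ρ hρ
    exact (hetale ρ hρ.1 hρ.2 n hn).le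
  have hlt (n : ℕ) (hn : 2 ≤ n) : ‖(n : K) * a n‖ * ‖y‖ ^ (n - 1) < ‖a 1‖ := by
    refine lt_of_le_of_lt ?_ (hetale (max ‖y‖ (1 / 2)) (lt_max_of_lt_right (by norm_num))
      (max_lt hy (by norm_num)) n hn)
    gcongr
    exact le_max_left _ _
  have hsum := (hconv x hx).hasSum.sub (hconv y hy).hasSum
  rw [← hf, ← hf, heq, sub_self] at hsum
  have hbound := (hsum.update 1 0).norm_lt_of_forall_norm_lt hC fun n => by
    match n with
    | 0 => simpa using hC
    | 1 => simpa using hC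
    | m + 2 =>
      rw [Function.update_of_ne (by omega)]
      exact norm_mul_pow_sub_pow_lt hp hpK hA (hle (m + 2) (by omega))
        (hlt (m + 2) (by omega)) hy.le hne hxy
  simp only [pow_one, zero_sub, add_zero, norm_neg, ← mul_sub, norm_mul] at hbound
  exact lt_irrefl _ hbound
end

section
/- Let K be a complete nonarchimedean normed field with ‖(p : K)‖ = (p : ℝ)⁻¹ for a prime p. Let a : ℕ → K be such that for every x ∈ K with ‖x‖ < 1 the series Σ_{n≥0} aₙ xⁿ is summable, and define f(x) = Σ'_{n≥0} aₙ xⁿ. Assume that for every real ρ with 0 < ρ < 1 and every integer n ≥ 2 one has ‖a₁‖ > ‖(n : K) · aₙ‖ · ρ^{n-1}. Then for all x, y ∈ K with ‖x‖ < (p : ℝ)^{-1/(p-1)} and ‖y‖ < (p : ℝ)^{-1/(p-1)} one has ‖f(x) − f(y)‖ = ‖a₁‖ · ‖x − y‖. -/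
open IsUltrametricDist in
/-- In a nonarchimedean field where `p` has norm less than one, integers prime to `p` are units
of norm one. -/
lemma norm_natCast_eq_one_of_coprime_s1 {K : Type*} [NormedField K] [IsUltrametricDist K]
    {p m : ℕ} (hpK : ‖(p : K)‖ < 1) (h : m.Coprime p) : ‖(m : K)‖ = 1 := by
  refine le_antisymm (norm_natCast_le_one K m) ?_
  by_contra! hm
  have key : (1 : K) = m * (m.gcdA p : ℤ) + p * (m.gcdB p : ℤ) := by
    have := Nat.gcd_eq_gcd_ab m p
    rw [h.gcd_eq_one] at this
    exact_mod_cast congrArg (Int.cast : ℤ → K) this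
  have hlt {b : K} (hb : ‖b‖ < 1) (z : ℤ) : ‖b * (z : K)‖ < 1 := by
    rw [norm_mul]
    exact (mul_le_of_le_one_right (norm_nonneg _) (norm_intCast_le_one K z)).trans_lt hb
  have h1 : ‖(1 : K)‖ < 1 := by
    rw [key]
    exact (norm_add_le_max _ _).trans_lt (max_lt (hlt hm _) (hlt hpK _))
  simp at h1

/-- If `R ^ (p - 1) = 1 / p`, then `R ^ (n - 1)` is a lower bound for the `p`-adic norm of `n`. -/
lemma pow_le_norm_natCast {K : Type*} [NormedField K] [IsUltrametricDist K]
    {p : ℕ} (hp : p.Prime) (hpK : ‖(p : K)‖ = (p : ℝ)⁻¹) {R : ℝ} (hR0 : 0 ≤ R) (hR1 : R ≤ 1)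
    (hR : R ^ (p - 1) = (p : ℝ)⁻¹) {n : ℕ} (hn : n ≠ 0) : R ^ (n - 1) ≤ ‖(n : K)‖ := by
  obtain ⟨k, m, hm, rfl⟩ := Nat.exists_eq_pow_mul_and_not_dvd hn p hp.ne_one
  have hpK1 : ‖(p : K)‖ < 1 := hpK ▸ inv_lt_one_of_one_lt₀ (by exact_mod_cast hp.one_lt)
  rw [Nat.cast_mul, Nat.cast_pow, norm_mul, norm_pow,
    norm_natCast_eq_one_of_coprime_s1 hpK1 ((hp.coprime_iff_not_dvd.2 hm).symm), mul_one, hpK, ← hR,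
    ← pow_mul]
  refine pow_le_pow_of_le_one hR0 hR1 ?_
  have hb : 1 + k * (p - 1) ≤ p ^ k := by
    have h := one_add_mul_le_pow (a := ((p - 1 : ℕ) : ℤ)) (by omega) k
    rw [Nat.cast_sub hp.one_le] at h
    zify [hp.one_le]
    simpa using h
  have hm0 : 0 < m := Nat.pos_of_ne_zero (by rintro rfl; simp at hm)
  have hle : p ^ k ≤ p ^ k * m := Nat.le_mul_of_pos_right _ hm0
  rw [mul_comm]
  omega

/-- In a nonarchimedean field, `x ↦ x ^ n` is Lipschitz with constant `r ^ (n - 1)` on the closed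
ball of radius `r`. -/
lemma norm_pow_sub_pow_le {K : Type*} [NormedField K] [IsUltrametricDist K]
    {x y : K} {r : ℝ} (hx : ‖x‖ ≤ r) (hy : ‖y‖ ≤ r) (n : ℕ) :
    ‖x ^ n - y ^ n‖ ≤ r ^ (n - 1) * ‖x - y‖ := by
  have hr : 0 ≤ r := (norm_nonneg x).trans hx
  rw [← geom_sum₂_mul, norm_mul]
  refine mul_le_mul_of_nonneg_right ?_ (norm_nonneg _)
  refine IsUltrametricDist.norm_sum_le_of_forall_le_of_nonneg (by positivity) fun i hi ↦ ?_
  have hi' := Finset.mem_range.1 hi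
  calc ‖x ^ i * y ^ (n - 1 - i)‖ = ‖x‖ ^ i * ‖y‖ ^ (n - 1 - i) := by simp
    _ ≤ r ^ i * r ^ (n - 1 - i) := by gcongr
    _ = r ^ (n - 1) := by rw [← pow_add]; congr 1; omega

/-- **Centered quantitative p-adic Rolle theorem.** Under Berkovich's étale coefficient
condition, the power series `f` is a scaled isometry (ratio `‖a₁‖`) on the open disk of
radius `p^(-1/(p-1))` around `0`. -/
theorem stmt_1 {K : Type*} [NormedField K] [IsUltrametricDist K] [CompleteSpace K]
    (p : ℕ) (hp : p.Prime) (hpK : ‖(p : K)‖ = (p : ℝ)⁻¹)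
    (a : ℕ → K)
    (hconv : ∀ x : K, ‖x‖ < 1 → Summable (fun n : ℕ => a n * x ^ n))
    (f : K → K) (hf : ∀ x : K, f x = ∑' n : ℕ, a n * x ^ n)
    (hetale : ∀ ρ : ℝ, 0 < ρ → ρ < 1 → ∀ n : ℕ, 2 ≤ n →
      ‖a 1‖ > ‖(n : K) * a n‖ * ρ ^ (n - 1))
    (x y : K) (hx : ‖x‖ < (p : ℝ) ^ (-1 / ((p : ℝ) - 1)))
    (hy : ‖y‖ < (p : ℝ) ^ (-1 / ((p : ℝ) - 1))) :
    ‖f x - f y‖ = ‖a 1‖ * ‖x - y‖ := by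
  obtain rfl | hxy := eq_or_ne x y
  · simp
  have hp1 : (1 : ℝ) < p := by exact_mod_cast hp.one_lt
  set R : ℝ := (p : ℝ) ^ (-1 / ((p : ℝ) - 1)) with hRdef
  have hR0 : 0 < R := Real.rpow_pos_of_pos (by linarith) _
  have hR1 : R < 1 :=
    Real.rpow_lt_one_of_one_lt_of_neg hp1 (div_neg_of_neg_of_pos (by norm_num) (by linarith))
  have hR : R ^ (p - 1) = (p : ℝ)⁻¹ := by
    rw [hRdef, ← Real.rpow_natCast, ← Real.rpow_mul (by linarith), Nat.cast_sub hp.one_le,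
      Nat.cast_one, div_mul_cancel₀ _ (by linarith), Real.rpow_neg_one]
  have ha1 : 0 < ‖a 1‖ :=
    (by positivity : (0 : ℝ) ≤ _).trans_lt (hetale 2⁻¹ (by norm_num) (by norm_num) 2 le_rfl)
  have hcoeff (n : ℕ) (hn : 2 ≤ n) : ‖(n : K)‖ * ‖a n‖ ≤ ‖a 1‖ := by
    have hcont : Continuous fun ρ : ℝ ↦ ‖(n : K) * a n‖ * ρ ^ (n - 1) := by fun_prop
    have hlim := (hcont.tendsto 1).mono_left (nhdsWithin_le_nhds (s := Set.Iio 1))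
    have hle := le_of_tendsto hlim (b := ‖a 1‖) (by
      filter_upwards [Ioo_mem_nhdsLT (zero_lt_one' ℝ)] with ρ hρ
      exact (hetale ρ hρ.1 hρ.2 n hn).le)
    simpa using hle
  set r : ℝ := max ‖x‖ ‖y‖
  have hr0 : 0 ≤ r := (norm_nonneg x).trans (le_max_left _ _)
  have hrR : r < R := max_lt hx hy
  have hbound (n : ℕ) (hn : 2 ≤ n) : ‖a n‖ * r ^ (n - 1) ≤ ‖a 1‖ * (r / R) := by
    have hc1 : r / R ≤ 1 := (div_le_one hR0).2 hrR.le
    calc ‖a n‖ * r ^ (n - 1) = R ^ (n - 1) * ‖a n‖ * (r / R) ^ (n - 1) := by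
          rw [div_pow]; field_simp
      _ ≤ ‖(n : K)‖ * ‖a n‖ * (r / R) ^ (n - 1) := by
          gcongr
          exact pow_le_norm_natCast hp hpK hR0.le hR1.le hR (by omega)
      _ ≤ ‖a 1‖ * (r / R) ^ 1 := by
          refine mul_le_mul (hcoeff n hn) ?_ (by positivity) (by positivity)
          exact pow_le_pow_of_le_one (by positivity) hc1 (by omega)
      _ = ‖a 1‖ * (r / R) := by rw [pow_one]
  have hsx := hconv x (hx.trans hR1)
  have hsy := hconv y (hy.trans hR1)
  have hexp : f x - f y = a 1 * (x - y) + ∑' n, a (n + 2) * (x ^ (n + 2) - y ^ (n + 2)) := by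
    rw [hf, hf, ← hsx.tsum_sub hsy, ← (hsx.sub hsy).sum_add_tsum_nat_add 2]
    simp [Finset.sum_range_succ, mul_sub]
  have hxy0 : 0 < ‖x - y‖ := norm_pos_iff.2 (sub_ne_zero.2 hxy)
  have htail : ‖∑' n, a (n + 2) * (x ^ (n + 2) - y ^ (n + 2))‖ < ‖a 1 * (x - y)‖ := by
    refine (IsUltrametricDist.norm_tsum_le_of_forall_le_of_nonneg
      (C := ‖a 1‖ * (r / R) * ‖x - y‖) (by positivity) fun n ↦ ?_).trans_lt ?_
    · rw [norm_mul]
      calc ‖a (n + 2)‖ * ‖x ^ (n + 2) - y ^ (n + 2)‖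
          ≤ ‖a (n + 2)‖ * (r ^ (n + 2 - 1) * ‖x - y‖) := by
            gcongr
            exact norm_pow_sub_pow_le (le_max_left _ _) (le_max_right _ _) _
        _ = ‖a (n + 2)‖ * r ^ (n + 2 - 1) * ‖x - y‖ := by ring
        _ ≤ _ := mul_le_mul_of_nonneg_right (hbound (n + 2) (by omega)) hxy0.le
    · rw [norm_mul]
      gcongr
      exact mul_lt_of_lt_one_right ha1 ((div_lt_one hR0).2 hrR)
  rw [hexp, IsUltrametricDist.norm_add_eq_max_of_norm_ne_norm htail.ne', max_eq_left htail.le,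
    norm_mul]
end

section
/- Let K be a complete nonarchimedean normed field, let r be a real number with 0 < r, and let a : ℕ → K be such that for every x ∈ K with ‖x‖ < r the series Σ_{n≥0} aₙ xⁿ is summable; define f(x) = Σ'_{n≥0} aₙ xⁿ. Assume that for every real ρ with 0 < ρ < r and every integer n ≥ 2 one has ‖a₁‖ > ‖aₙ‖ · ρ^{n-1}. Then f is injective on the open disk of radius r: for all x, y ∈ K with ‖x‖ < r and ‖y‖ < r, f(x) = f(y) implies x = y. -/
theorem norm_pow_sub_pow_le_of_ultrametric {K : Type*} [NormedField K] [IsUltrametricDist K]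
    {x y : K} {ρ : ℝ} (hx : ‖x‖ ≤ ρ) (hy : ‖y‖ ≤ ρ) (n : ℕ) :
    ‖x ^ n - y ^ n‖ ≤ ρ ^ (n - 1) * ‖x - y‖ := by
  have hρ : 0 ≤ ρ := (norm_nonneg x).trans hx
  rw [← geom_sum₂_mul, norm_mul]
  gcongr
  refine IsUltrametricDist.norm_sum_le_of_forall_le_of_nonneg (by positivity) fun i hi => ?_
  have hi : i < n := Finset.mem_range.mp hi
  calc ‖x ^ i * y ^ (n - 1 - i)‖ = ‖x‖ ^ i * ‖y‖ ^ (n - 1 - i) := by simp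
    _ ≤ ρ ^ i * ρ ^ (n - 1 - i) := by gcongr
    _ = ρ ^ (n - 1) := by rw [← pow_add]; congr 1; omega

/-- **Condition (2), injectivity.** The coefficient bound `‖a₁‖ > ‖aₙ‖·ρ^(n-1)` for all
`0 < ρ < r` and `n ≥ 2` forces the power series `f` to be injective on the open disk of
radius `r`. -/
theorem stmt_4 {K : Type*} [NormedField K] [IsUltrametricDist K] [CompleteSpace K]
    (r : ℝ) (hr : 0 < r) (a : ℕ → K)
    (hconv : ∀ x : K, ‖x‖ < r → Summable (fun n : ℕ => a n * x ^ n))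
    (f : K → K) (hf : ∀ x : K, f x = ∑' n : ℕ, a n * x ^ n)
    (hcoef : ∀ ρ : ℝ, 0 < ρ → ρ < r → ∀ n : ℕ, 2 ≤ n → ‖a 1‖ > ‖a n‖ * ρ ^ (n - 1))
    (x y : K) (hx : ‖x‖ < r) (hy : ‖y‖ < r) (heq : f x = f y) : x = y := by
  by_contra hxy
  have hd : 0 < ‖x - y‖ := norm_pos_iff.mpr (sub_ne_zero.mpr hxy)
  obtain ⟨ρ, hρ, hρr⟩ := exists_between (max_lt hx hy)
  set s := max ‖x‖ ‖y‖
  have hs0 : 0 ≤ s := (norm_nonneg x).trans (le_max_left _ _)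
  have hρ0 : 0 < ρ := hs0.trans_lt hρ
  have ha : 0 < ‖a 1‖ := lt_of_le_of_lt (by positivity) (hcoef ρ hρ0 hρr 2 le_rfl)
  have hq : s / ρ < 1 := (div_lt_one hρ0).mpr hρ
  have hsum : HasSum (fun n => a n * x ^ n - a n * y ^ n) 0 := by
    have := (hconv x hx).hasSum.sub (hconv y hy).hasSum
    rwa [← hf, ← hf, heq, sub_self] at this
  have hsplit := hsum.summable.tsum_eq_add_tsum_ite 1
  rw [hsum.tsum_eq] at hsplit
  have hbound : ‖∑' n, if n = 1 then 0 else a n * x ^ n - a n * y ^ n‖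
      ≤ ‖a 1‖ * (s / ρ) * ‖x - y‖ := by
    refine IsUltrametricDist.norm_tsum_le_of_forall_le_of_nonneg (by positivity) fun n => ?_
    obtain rfl | rfl | hn : n = 0 ∨ n = 1 ∨ 2 ≤ n := by omega
    · simp; positivity
    · simp; positivity
    rw [if_neg (by omega), ← mul_sub, norm_mul]
    calc ‖a n‖ * ‖x ^ n - y ^ n‖ ≤ ‖a n‖ * (s ^ (n - 1) * ‖x - y‖) := by
          gcongr
          exact norm_pow_sub_pow_le_of_ultrametric (le_max_left _ _) (le_max_right _ _) n
      _ = ‖a n‖ * ρ ^ (n - 1) * (s / ρ) ^ (n - 1) * ‖x - y‖ := by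
          rw [div_pow]; field_simp
      _ ≤ ‖a 1‖ * (s / ρ) * ‖x - y‖ := by
          gcongr
          · exact (hcoef ρ hρ0 hρr n hn).le
          · exact pow_le_of_le_one (by positivity) hq.le (by omega)
  rw [← norm_neg, ← eq_neg_of_add_eq_zero_left hsplit.symm, pow_one, pow_one, ← mul_sub,
    norm_mul, mul_right_comm] at hbound
  exact absurd hbound (not_le.mpr (mul_lt_of_lt_one_right (by positivity) hq))
end

section
/- Let K be a complete nonarchimedean normed field that is algebraically closed, let r be a real number with 0 < r, and let a : ℕ → K be such that for every x ∈ K with ‖x‖ < r the series Σ_{n≥0} aₙ xⁿ is summable; define f(x) = Σ'_{n≥0} aₙ xⁿ. Assume that for every real ρ with 0 < ρ < r and every integer n ≥ 2 one has ‖a₁‖ > ‖aₙ‖ · ρ^{n-1}. Then the image under f of the open disk {x : ‖x‖ < r} is exactly the open disk {b : ‖b − a₀‖ < ‖a₁‖ · r}; in particular, for every b ∈ K with ‖b − a₀‖ < ‖a₁‖ · r there exists x ∈ K with ‖x‖ < r and f(x) = b. -/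
/-- The ultrametric Lipschitz estimate for powers on a closed ball. -/
theorem IsUltrametricDist.norm_pow_succ_sub_pow_succ_le {K : Type*} [NormedField K]
    [IsUltrametricDist K] {x y : K} {s : ℝ} (hx : ‖x‖ ≤ s) (hy : ‖y‖ ≤ s) (n : ℕ) :
    ‖x ^ (n + 1) - y ^ (n + 1)‖ ≤ s ^ n * ‖x - y‖ := by
  have hs : 0 ≤ s := (norm_nonneg x).trans hx
  rw [← geom_sum₂_mul, norm_mul]
  refine mul_le_mul_of_nonneg_right ?_ (norm_nonneg _)
  refine IsUltrametricDist.norm_sum_le_of_forall_le_of_nonneg (pow_nonneg hs n) fun i hi => ?_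
  have hi : i + (n - i) = n := by
    have := Finset.mem_range.1 hi
    omega
  calc ‖x ^ i * y ^ (n + 1 - 1 - i)‖ = ‖x‖ ^ i * ‖y‖ ^ (n - i) := by simp
    _ ≤ s ^ i * s ^ (n - i) := by gcongr
    _ = s ^ n := by rw [← pow_add, hi]

/-- If the higher coefficients are dominated by `q * ‖a 1‖` on the closed ball of radius `s`, then
a convergent power series is `q * ‖a 1‖`-close, in the Lipschitz sense, to its linear part. -/
theorem IsUltrametricDist.norm_tsum_sub_tsum_sub_linear_le {K : Type*} [NormedField K]
    [IsUltrametricDist K] {a : ℕ → K} {x y : K} {s q : ℝ}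
    (ha : ∀ n, ‖a (n + 2)‖ * s ^ (n + 1) ≤ q * ‖a 1‖) (hx : ‖x‖ ≤ s) (hy : ‖y‖ ≤ s)
    (hsx : Summable fun n => a n * x ^ n) (hsy : Summable fun n => a n * y ^ n) :
    ‖(∑' n, a n * x ^ n) - (∑' n, a n * y ^ n) - a 1 * (x - y)‖ ≤ q * ‖a 1‖ * ‖x - y‖ := by
  have htail : (∑' n, a n * x ^ n) - (∑' n, a n * y ^ n) - a 1 * (x - y) =
      ∑' n, a (n + 2) * (x ^ (n + 2) - y ^ (n + 2)) := by
    rw [← hsx.tsum_sub hsy, ← (hsx.sub hsy).sum_add_tsum_nat_add 2]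
    simp only [Finset.sum_range_succ, Finset.sum_range_zero, mul_sub]
    ring
  rw [htail]
  refine IsUltrametricDist.norm_tsum_le_of_forall_le fun n => ?_
  rw [norm_mul]
  calc ‖a (n + 2)‖ * ‖x ^ (n + 2) - y ^ (n + 2)‖
      ≤ ‖a (n + 2)‖ * (s ^ (n + 1) * ‖x - y‖) := by
        gcongr
        exact norm_pow_succ_sub_pow_succ_le hx hy (n + 1)
    _ = ‖a (n + 2)‖ * s ^ (n + 1) * ‖x - y‖ := by ring
    _ ≤ q * ‖a 1‖ * ‖x - y‖ := mul_le_mul_of_nonneg_right (ha n) (norm_nonneg _)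

/-- A map on a closed ball around `0` that is close enough to multiplication by `c` hits every
point within `‖c‖ * s` of its value at `0`. -/
theorem IsUltrametricDist.exists_eq_of_norm_sub_sub_mul_le {K : Type*} [NormedField K]
    [IsUltrametricDist K] [CompleteSpace K] {f : K → K} {c b : K} {s q : ℝ} (hc : c ≠ 0)
    (hs : 0 ≤ s) (hq : 0 ≤ q) (hq1 : q < 1)
    (hf : ∀ x y, ‖x‖ ≤ s → ‖y‖ ≤ s → ‖f x - f y - c * (x - y)‖ ≤ q * ‖c‖ * ‖x - y‖)
    (hb : ‖b - f 0‖ ≤ ‖c‖ * s) : ∃ x, ‖x‖ ≤ s ∧ f x = b := by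
  have hc' : 0 < ‖c‖ := norm_pos_iff.2 hc
  let g : K → K := fun x => x - (f x - b) / c
  have hg : ∀ x y, ‖x‖ ≤ s → ‖y‖ ≤ s → ‖g x - g y‖ ≤ q * ‖x - y‖ := fun x y hx hy => by
    have : g x - g y = -((f x - f y - c * (x - y)) / c) := by
      simp only [g]
      field_simp
      ring
    rw [this, norm_neg, norm_div, div_le_iff₀ hc']
    linarith [hf x y hx hy]
  have h0 : ‖(0 : K)‖ ≤ s := by simpa
  have hg0 : ‖g 0‖ ≤ s := by
    simp only [g, zero_sub, norm_neg, norm_div]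
    rw [div_le_iff₀ hc', norm_sub_rev]
    linarith
  have hmaps : Set.MapsTo g (Metric.closedBall 0 s) (Metric.closedBall 0 s) := fun x hx => by
    rw [mem_closedBall_zero_iff] at hx ⊢
    rw [← sub_add_cancel (g x) (g 0)]
    refine (IsUltrametricDist.norm_add_le_max _ _).trans (max_le ?_ hg0)
    refine (hg x 0 hx h0).trans ?_
    rw [sub_zero]
    exact (mul_le_of_le_one_left (norm_nonneg x) hq1.le).trans hx
  have hcontr : ContractingWith ⟨q, hq⟩ (hmaps.restrict g _ _) :=
    ⟨hq1, LipschitzWith.of_dist_le_mul fun x y => by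
      rw [Subtype.dist_eq, Subtype.dist_eq, dist_eq_norm, dist_eq_norm]
      exact hg x y (mem_closedBall_zero_iff.1 x.2) (mem_closedBall_zero_iff.1 y.2)⟩
  obtain ⟨x, hx, hfix, -⟩ := hcontr.exists_fixedPoint' Metric.isClosed_closedBall.isComplete
    hmaps (mem_closedBall_zero_iff.2 h0) (edist_ne_top _ _)
  refine ⟨x, mem_closedBall_zero_iff.1 hx, ?_⟩
  have : (f x - b) / c = 0 := sub_eq_self.1 hfix
  exact sub_eq_zero.1 ((div_eq_zero_iff.1 this).resolve_right hc)


/-- **Condition (2), open-immersion content.** Over a complete algebraically closed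
nonarchimedean field, under the coefficient bound `‖a₁‖ > ‖aₙ‖·ρ^(n-1)` (`0 < ρ < r`,
`n ≥ 2`), the power series `f` maps the open disk of radius `r` onto the open disk of
radius `‖a₁‖·r` centered at `a₀ = f(0)`. -/
theorem stmt_8 {K : Type*} [NormedField K] [IsUltrametricDist K] [CompleteSpace K]
    [IsAlgClosed K]
    (r : ℝ) (hr : 0 < r) (a : ℕ → K)
    (hconv : ∀ x : K, ‖x‖ < r → Summable (fun n : ℕ => a n * x ^ n))
    (f : K → K) (hf : ∀ x : K, f x = ∑' n : ℕ, a n * x ^ n)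
    (hcoef : ∀ ρ : ℝ, 0 < ρ → ρ < r → ∀ n : ℕ, 2 ≤ n → ‖a 1‖ > ‖a n‖ * ρ ^ (n - 1)) :
    f '' {x : K | ‖x‖ < r} = {b : K | ‖b - a 0‖ < ‖a 1‖ * r} := by
  have hc : 0 < ‖a 1‖ :=
    (by positivity : 0 ≤ ‖a 2‖ * (r / 2) ^ (2 - 1)).trans_lt
      (hcoef (r / 2) (by linarith) (by linarith) 2 le_rfl)
  have hf0 : f 0 = a 0 := by
    rw [hf, tsum_eq_single 0 fun n hn => by simp [hn]]
    simp
  have hlin : ∀ s, 0 ≤ s → s < r → ∃ q, 0 ≤ q ∧ q < 1 ∧ ∀ x y, ‖x‖ ≤ s → ‖y‖ ≤ s →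
      ‖f x - f y - a 1 * (x - y)‖ ≤ q * ‖a 1‖ * ‖x - y‖ := by
    intro s hs hsr
    obtain ⟨ρ, hsρ, hρr⟩ := exists_between hsr
    have hρ : 0 < ρ := hs.trans_lt hsρ
    have hq : 0 ≤ s / ρ := by positivity
    have hq1 : s / ρ < 1 := (div_lt_one hρ).2 hsρ
    refine ⟨s / ρ, hq, hq1, fun x y hx hy => ?_⟩
    rw [hf, hf]
    refine IsUltrametricDist.norm_tsum_sub_tsum_sub_linear_le (fun n => ?_) hx hy
      (hconv x (hx.trans_lt hsr)) (hconv y (hy.trans_lt hsr))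
    calc ‖a (n + 2)‖ * s ^ (n + 1)
        = (s / ρ) ^ (n + 1) * (‖a (n + 2)‖ * ρ ^ (n + 1)) := by
          rw [div_pow]
          field_simp
      _ ≤ s / ρ * ‖a 1‖ :=
          mul_le_mul (pow_le_of_le_one hq hq1.le n.succ_ne_zero)
            (hcoef ρ hρ hρr (n + 2) (by omega)).le (by positivity) hq
  ext b
  constructor
  · rintro ⟨x, hx, rfl⟩
    obtain ⟨q, -, hq1, h⟩ := hlin ‖x‖ (norm_nonneg x) hx
    have h := h x 0 le_rfl (by simp)
    rw [hf0, sub_zero] at h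
    refine lt_of_le_of_lt ?_ (mul_lt_mul_of_pos_left hx hc)
    rw [← sub_add_cancel (f x - a 0) (a 1 * x)]
    refine (IsUltrametricDist.norm_add_le_max _ _).trans (max_le (h.trans ?_) (norm_mul _ _).le)
    gcongr
    exact mul_le_of_le_one_left hc.le hq1.le
  · intro hb
    have hsr : ‖b - a 0‖ / ‖a 1‖ < r := (div_lt_iff₀' hc).2 hb
    have hs : 0 ≤ ‖b - a 0‖ / ‖a 1‖ := by positivity
    obtain ⟨q, hq, hq1, h⟩ := hlin _ hs hsr
    obtain ⟨x, hx, hxb⟩ := IsUltrametricDist.exists_eq_of_norm_sub_sub_mul_le (b := b)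
      (norm_pos_iff.1 hc) hs hq hq1 h (by rw [hf0, mul_div_cancel₀ _ hc.ne'])
    exact ⟨x, hx.trans_lt hsr, hxb⟩
end

section
/- Let K be a complete nonarchimedean normed field of characteristic zero that is algebraically closed. Let a : ℕ → K be such that for every x ∈ K with ‖x‖ < 1 the series Σ_{n≥0} aₙ xⁿ is summable; define f(x) = Σ'_{n≥0} aₙ xⁿ. If f is injective on the open unit disk (for all x, y with ‖x‖ < 1 and ‖y‖ < 1, f(x) = f(y) implies x = y), then for all x, y with ‖x‖ < 1 and ‖y‖ < 1 one has ‖f(x) − f(y)‖ = ‖a₁‖ · ‖x − y‖. -/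
open Polynomial Filter Topology

section Polynomials

variable {K : Type*} [NormedField K] [IsUltrametricDist K]

/-- If all roots of a split polynomial have norm at least `δ`, then its constant coefficient
dominates all coefficients for the Gauss norm of radius `δ`. -/
lemma Polynomial.Splits.norm_coeff_mul_pow_le_norm_coeff_zero {p : K[X]} (hp : p.Splits) {δ : ℝ}
    (hδ : 0 ≤ δ) (hroots : ∀ w ∈ p.roots, δ ≤ ‖w‖) (k : ℕ) :
    ‖p.coeff k‖ * δ ^ k ≤ ‖p.coeff 0‖ := by
  let P : K[X] → Prop := fun q => ∀ k, ‖q.coeff k‖ * δ ^ k ≤ ‖q.coeff 0‖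
  have hmul : ∀ q₁ q₂, P q₁ → P q₂ → P (q₁ * q₂) := by
    intro q₁ q₂ h₁ h₂ k
    have hk : ‖(q₁ * q₂).coeff k‖ * δ ^ k ≤ ‖q₁.coeff 0‖ * ‖q₂.coeff 0‖ := by
      rcases hδ.eq_or_lt with rfl | hδ'
      · rcases k with _ | k
        · simp [mul_coeff_zero]
        · simp; positivity
      rw [← le_div_iff₀ (by positivity), coeff_mul]
      refine IsUltrametricDist.norm_sum_le_of_forall_le_of_nonneg (by positivity) ?_
      rintro ⟨i, j⟩ hij
      obtain rfl : i + j = k := by simpa using hij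
      rw [le_div_iff₀ (by positivity), norm_mul, pow_add]
      calc _ = (‖q₁.coeff i‖ * δ ^ i) * (‖q₂.coeff j‖ * δ ^ j) := by ring
        _ ≤ _ := mul_le_mul (h₁ i) (h₂ j) (by positivity) (by positivity)
    simpa [mul_coeff_zero] using hk
  have hC : ∀ a : K, P (C a) := by
    rintro a (_ | k)
    · simp
    · simp [coeff_C]
  suffices P p from this k
  rw [hp.eq_prod_roots]
  refine hmul _ _ (hC _) (Multiset.prod_induction P _ hmul (by simpa using hC 1) ?_)
  intro q hq
  obtain ⟨a, ha, rfl⟩ := Multiset.mem_map.mp hq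
  rintro (_ | _ | k)
  · simp
  · simpa using hroots a ha
  · simp [coeff_X, coeff_C]

/-- If the `N`-th coefficient of `p` strictly dominates the later ones on the closed disk of
radius `r`, then it has the same norm as the `N`-th Taylor coefficient of `p` at any point of
this disk. -/
lemma Polynomial.norm_taylor_coeff_eq_of_forall_lt {p : K[X]} {N : ℕ} {r : ℝ} (hr : 0 < r)
    (hN : ∀ n > N, ‖p.coeff n‖ * r ^ n < ‖p.coeff N‖ * r ^ N) {z : K} (hz : ‖z‖ ≤ r) :
    ‖(taylor z p).coeff N‖ = ‖p.coeff N‖ := by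
  have hpos : 0 < ‖p.coeff N‖ := by
    have := (by positivity : 0 ≤ ‖p.coeff (N + 1)‖ * r ^ (N + 1)).trans_lt (hN _ N.lt_succ_self)
    exact pos_of_mul_pos_left this (by positivity)
  rw [taylor_coeff, eval_eq_sum_range, Finset.sum_range_succ', hasseDeriv_coeff]
  simp only [zero_add, Nat.choose_self, Nat.cast_one, one_mul, pow_zero, mul_one]
  set S := ∑ i ∈ Finset.range (hasseDeriv N p).natDegree,
    (hasseDeriv N p).coeff (i + 1) * z ^ (i + 1)
  have hS : ‖S‖ < ‖p.coeff N‖ := by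
    rcases (Finset.range (hasseDeriv N p).natDegree).eq_empty_or_nonempty with h | h
    · simpa [S, h] using hpos
    obtain ⟨i, -, hi⟩ := IsUltrametricDist.exists_norm_finsetSum_le_of_nonempty h
      (fun i => (hasseDeriv N p).coeff (i + 1) * z ^ (i + 1))
    refine hi.trans_lt ?_
    rw [hasseDeriv_coeff, norm_mul, norm_mul, norm_pow]
    have hlt := hN (i + 1 + N) (by omega)
    rw [pow_add, ← mul_assoc] at hlt
    refine lt_of_le_of_lt ?_ (lt_of_mul_lt_mul_right hlt (by positivity))
    gcongr
    exact mul_le_of_le_one_left (norm_nonneg _) (IsUltrametricDist.norm_natCast_le_one K _)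
  rw [IsUltrametricDist.norm_add_eq_max_of_norm_ne_norm hS.ne, max_eq_right hS.le]

/-- A polynomial that takes a small value at a point of the closed disk of radius `r` has a root
near this point. -/
lemma Polynomial.exists_isRoot_norm_sub_pow_mul_le [IsAlgClosed K] {p : K[X]} {N : ℕ} (hN0 : N ≠ 0)
    {r : ℝ} (hr : 0 < r) (hN : ∀ n > N, ‖p.coeff n‖ * r ^ n < ‖p.coeff N‖ * r ^ N)
    {z : K} (hz : ‖z‖ ≤ r) :
    ∃ w, p.IsRoot w ∧ ‖w - z‖ ^ N * ‖p.coeff N‖ ≤ ‖p.eval z‖ := by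
  have hNp : p.coeff N ≠ 0 := by
    intro h
    have := hN (N + 1) N.lt_succ_self
    rw [h, norm_zero, zero_mul] at this
    exact absurd this (not_lt.mpr (by positivity))
  have hp0 : p ≠ 0 := by rintro rfl; simp at hNp
  have hdeg : p.degree ≠ 0 := by
    intro h
    have := le_natDegree_of_ne_zero hNp
    exact hN0 (Nat.le_zero.mp (this.trans_eq (natDegree_eq_of_degree_eq_some h)))
  obtain ⟨w₀, hw₀⟩ := IsAlgClosed.exists_root p hdeg
  classical
  obtain ⟨w, hw, hmin⟩ := p.roots.toFinset.exists_min_image (fun w => ‖w - z‖)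
    ⟨w₀, by simpa [hp0] using hw₀⟩
  refine ⟨w, by simpa [hp0] using hw, ?_⟩
  have h := (IsAlgClosed.splits (taylor z p)).norm_coeff_mul_pow_le_norm_coeff_zero
    (norm_nonneg (w - z)) (fun u hu => ?_) N
  · rwa [norm_taylor_coeff_eq_of_forall_lt hr hN hz, taylor_coeff_zero, mul_comm] at h
  · have hroot : p.IsRoot (u + z) := by
      have := (mem_roots'.mp hu).2
      simpa [taylor_eval] using this
    simpa using hmin (u + z) (by simpa [hp0] using hroot)

end Polynomials

/-- A real sequence tending to zero, with a positive term, has a last maximal term. -/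
lemma exists_last_max_of_tendsto_zero {u : ℕ → ℝ} (hu : Tendsto u atTop (𝓝 0)) {n : ℕ}
    (hn : 0 < u n) : ∃ N, (∀ k, u k ≤ u N) ∧ ∀ k > N, u k < u N := by
  have hfin : ∀ c > 0, {k | c ≤ u k}.Finite := fun c hc => by
    obtain ⟨M, hM⟩ := eventually_atTop.mp (hu.eventually_lt_const hc)
    exact (Set.finite_lt_nat M).subset fun k hk => by
      by_contra h
      exact absurd (hM k (not_lt.mp h)) (not_lt.mpr hk)
  obtain ⟨m, hm, hmax⟩ := Set.exists_max_image _ u (hfin _ hn) ⟨n, le_refl (u n)⟩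
  have hm0 : 0 < u m := hn.trans_le hm
  obtain ⟨N, hN, hNmax⟩ := Set.exists_max_image _ id (hfin _ hm0) ⟨m, le_refl (u m)⟩
  have hle : ∀ k, u k ≤ u m := fun k => by
    rcases le_total (u n) (u k) with h | h
    · exact hmax k h
    · exact h.trans hm
  refine ⟨N, fun k => (hle k).trans hN, fun k hk => lt_of_lt_of_le ?_ hN⟩
  by_contra h
  exact absurd (hNmax k (not_lt.mp h)) (not_le.mpr hk)

section PowerSeries

variable {K : Type*} [NormedField K] [IsUltrametricDist K]

lemma norm_pow_sub_pow_mul_le {x y : K} {r : ℝ} (hx : ‖x‖ ≤ r) (hy : ‖y‖ ≤ r) (n : ℕ) :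
    ‖x ^ (n + 1) - y ^ (n + 1)‖ ≤ r ^ n * ‖x - y‖ := by
  have hr : 0 ≤ r := (norm_nonneg x).trans hx
  rw [← (Commute.all x y).geom_sum₂_mul (n + 1), norm_mul]
  gcongr
  refine IsUltrametricDist.norm_sum_le_of_forall_le_of_nonneg (by positivity) fun i hi => ?_
  have hi : i ≤ n := by simpa [Nat.lt_succ_iff] using hi
  rw [norm_mul, norm_pow, norm_pow]
  calc _ ≤ r ^ i * r ^ (n + 1 - 1 - i) := by gcongr
    _ = r ^ n := by rw [← pow_add]; congr 1; omega

/-- A power series over a complete algebraically closed nonarchimedean field which has positive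
Weierstrass degree `N` on the closed disk of radius `r` has a zero in this disk. -/
lemma exists_hasSum_zero_of_weierstrass_degree_pos [CompleteSpace K] [IsAlgClosed K]
    {c : ℕ → K} {r : ℝ} (hr : 0 < r) (hc : Tendsto (fun n => ‖c n‖ * r ^ n) atTop (𝓝 0))
    {N : ℕ} (hN0 : N ≠ 0) (hmax : ∀ n, ‖c n‖ * r ^ n ≤ ‖c N‖ * r ^ N)
    (hlast : ∀ n > N, ‖c n‖ * r ^ n < ‖c N‖ * r ^ N) :
    ∃ z : K, ‖z‖ ≤ r ∧ HasSum (fun n => c n * z ^ n) 0 := by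
  have hcN : 0 < ‖c N‖ := by
    have := (by positivity : 0 ≤ ‖c (N + 1)‖ * r ^ (N + 1)).trans_lt (hlast _ N.lt_succ_self)
    exact pos_of_mul_pos_left this (by positivity)
  let Q : ℕ → K[X] := fun M => ∑ i ∈ Finset.range M, monomial i (c i)
  have hQc : ∀ M n, (Q M).coeff n = if n < M then c n else 0 := fun M n => by
    simp [Q, finsetSum_coeff, coeff_monomial]
  have hQe : ∀ M z, (Q M).eval z = ∑ i ∈ Finset.range M, c i * z ^ i := fun M z => by
    simp [Q, eval_finsetSum]
  have hQN : ∀ M > N, ∀ n > N,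
      ‖(Q M).coeff n‖ * r ^ n < ‖(Q M).coeff N‖ * r ^ N := by
    intro M hM n hn
    rw [hQc, hQc, if_pos hM]
    split_ifs
    · exact hlast n hn
    · rw [norm_zero, zero_mul]; positivity
  have hroot : ∀ M > N, ∀ z : K, ‖z‖ ≤ r → ‖(Q M).eval z‖ ≤ ‖c N‖ * r ^ N →
      ∃ w, ‖w‖ ≤ r ∧ (Q M).eval w = 0 ∧ ‖w - z‖ ^ N * ‖c N‖ ≤ ‖(Q M).eval z‖ := by
    intro M hM z hz hle
    obtain ⟨w, hw, hwz⟩ := exists_isRoot_norm_sub_pow_mul_le hN0 hr (hQN M hM) hz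
    rw [hQc, if_pos hM] at hwz
    refine ⟨w, ?_, hw, hwz⟩
    have h1 : ‖w - z‖ ≤ r := by
      refine le_of_pow_le_pow_left₀ hN0 hr.le (le_of_mul_le_mul_right ?_ hcN)
      rw [mul_comm (r ^ N)]
      exact hwz.trans hle
    simpa using (IsUltrametricDist.norm_add_le_max (w - z) z).trans (max_le h1 hz)
  have hstep : ∀ (M : ℕ) (z : K), M > N → ‖z‖ ≤ r → (Q M).eval z = 0 →
      ∃ w, ‖w‖ ≤ r ∧ (Q (M + 1)).eval w = 0 ∧ ‖w - z‖ ^ N * ‖c N‖ ≤ ‖c M‖ * r ^ M := by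
    intro M z hM hz h0
    have hval : ‖(Q (M + 1)).eval z‖ ≤ ‖c M‖ * r ^ M := by
      rw [hQe, Finset.sum_range_succ, ← hQe, h0, zero_add, norm_mul, norm_pow]
      gcongr
    obtain ⟨w, hw, hw0, hwz⟩ := hroot (M + 1) (by omega) z hz (hval.trans (hmax M))
    exact ⟨w, hw, hw0, hwz.trans hval⟩
  obtain ⟨z₀, hz₀, hz₀0, -⟩ := hroot (N + 1) N.lt_succ_self 0 (by simpa using hr.le) (by
    have h0 : (Q (N + 1)).eval 0 = c 0 := by
      rw [← coeff_zero_eq_eval_zero, hQc, if_pos (by omega)]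
    rw [h0]
    simpa using hmax 0)
  choose! φ hφr hφ0 hφd using hstep
  let z : ℕ → K := fun k => Nat.rec z₀ (fun k w => φ (N + 1 + k) w) k
  have hz : ∀ k, ‖z k‖ ≤ r ∧ (Q (N + 1 + k)).eval (z k) = 0 := by
    intro k
    induction k with
    | zero => exact ⟨hz₀, hz₀0⟩
    | succ k ih =>
      exact ⟨hφr _ _ (by omega) ih.1 ih.2, hφ0 _ _ (by omega) ih.1 ih.2⟩
  have hshift : Tendsto (fun k => N + 1 + k) atTop atTop :=
    tendsto_atTop_mono (fun k => Nat.le_add_left k (N + 1)) tendsto_id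
  have hcauchy : CauchySeq z := by
    apply NonarchimedeanAddGroup.cauchySeq_of_tendsto_sub_nhds_zero
    rw [tendsto_zero_iff_norm_tendsto_zero]
    have hpow : Tendsto (fun k => ‖z (k + 1) - z k‖ ^ N) atTop (𝓝 0) := by
      refine squeeze_zero (fun k => by positivity) (fun k => ?_)
        (by simpa using (hc.comp hshift).div_const ‖c N‖)
      rw [le_div_iff₀ hcN]
      exact hφd _ _ (by omega) (hz k).1 (hz k).2
    have := hpow.rpow_const (p := (N : ℝ)⁻¹) (Or.inr (by positivity))
    rw [Real.zero_rpow (by positivity)] at this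
    refine this.congr fun k => ?_
    exact Real.pow_rpow_inv_natCast (norm_nonneg _) hN0
  obtain ⟨ζ, hζ⟩ := cauchySeq_tendsto_of_complete hcauchy
  have hζr : ‖ζ‖ ≤ r := le_of_tendsto hζ.norm (Eventually.of_forall fun k => (hz k).1)
  have hsum : Summable fun n => c n * ζ ^ n := by
    apply NonarchimedeanAddGroup.summable_of_tendsto_cofinite_zero
    rw [Nat.cofinite_eq_atTop, tendsto_zero_iff_norm_tendsto_zero]
    refine squeeze_zero (fun k => by positivity) (fun k => ?_) hc
    rw [norm_mul, norm_pow]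
    gcongr
  have hlim : Tendsto (fun k => (Q (N + 1 + k)).eval ζ) atTop (𝓝 0) := by
    rw [tendsto_zero_iff_norm_tendsto_zero]
    refine squeeze_zero (g := fun k => ‖c N‖ * r ^ N / r * ‖ζ - z k‖) (fun k => by positivity)
      (fun k => ?_) ?_
    · rw [← sub_zero ((Q (N + 1 + k)).eval ζ), ← (hz k).2, hQe, hQe, ← Finset.sum_sub_distrib]
      refine IsUltrametricDist.norm_sum_le_of_forall_le_of_nonneg (by positivity) ?_
      rintro (_ | i) -
      · simp; positivity
      rw [← mul_sub, norm_mul]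
      calc _ ≤ ‖c (i + 1)‖ * (r ^ i * ‖ζ - z k‖) := by
            gcongr; exact norm_pow_sub_pow_mul_le hζr (hz k).1 i
        _ = ‖c (i + 1)‖ * r ^ (i + 1) / r * ‖ζ - z k‖ := by
            rw [pow_succ]; field_simp
        _ ≤ _ := by gcongr ?_ / r * _; exact hmax (i + 1)
    · simpa using (hζ.const_sub ζ).norm.const_mul (‖c N‖ * r ^ N / r)
  refine ⟨ζ, hζr, ?_⟩
  have h := hsum.hasSum.tendsto_sum_nat.comp hshift
  have heq := tendsto_nhds_unique (h.congr fun k => (hQe _ _).symm) hlim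
  simpa [heq] using hsum.hasSum

/-- The constant coefficient of a power series without zeros on an open disk dominates all its
coefficients on this disk. -/
lemma norm_coeff_mul_pow_le_of_forall_not_hasSum_zero [CompleteSpace K] [IsAlgClosed K]
    {c : ℕ → K} {R : ℝ} (hc : ∀ x : K, ‖x‖ < R → Summable fun n => c n * x ^ n)
    (hne : ∀ x : K, ‖x‖ < R → ¬ HasSum (fun n => c n * x ^ n) 0) {ρ : ℝ} (hρ : 0 < ρ) (hρR : ρ < R)
    (n : ℕ) : ‖c n‖ * ρ ^ n ≤ ‖c 0‖ := by
  by_contra! hlt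
  have hn : n ≠ 0 := by rintro rfl; simp at hlt
  have hcn : c n ≠ 0 := by
    intro h
    rw [h, norm_zero, zero_mul] at hlt
    exact absurd hlt (not_lt.mpr (norm_nonneg _))
  have hc0 : c 0 ≠ 0 := by
    intro h
    refine hne 0 (by simpa using hρ.trans hρR) ?_
    convert! hasSum_zero using 2 with k
    rcases k with _ | k <;> simp [h]
  obtain ⟨t, ht⟩ := IsAlgClosed.exists_pow_nat_eq (c 0 / c n) (Nat.pos_of_ne_zero hn)
  have htn : ‖c n‖ * ‖t‖ ^ n = ‖c 0‖ := by
    rw [← norm_pow, ht, norm_div]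
    field_simp [norm_ne_zero_iff.mpr hcn]
  have ht0 : 0 < ‖t‖ := by
    rw [norm_pos_iff]
    rintro rfl
    rw [norm_zero, zero_pow hn, mul_zero] at htn
    exact hc0 (norm_eq_zero.mp htn.symm)
  have htR : ‖t‖ < R := by
    refine lt_of_le_of_lt (le_of_lt ?_) hρR
    refine lt_of_pow_lt_pow_left₀ n hρ.le ?_
    exact lt_of_mul_lt_mul_left (htn.trans_lt hlt) (norm_nonneg _)
  have htend : Tendsto (fun k => ‖c k‖ * ‖t‖ ^ k) atTop (𝓝 0) := by
    simpa using (hc t htR).tendsto_atTop_zero.norm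
  obtain ⟨N, hmax, hlast⟩ := exists_last_max_of_tendsto_zero htend (n := 0) (by simpa using hc0)
  have hN0 : N ≠ 0 := by
    rintro rfl
    have := hlast n (Nat.pos_of_ne_zero hn)
    rw [htn] at this
    simp at this
  obtain ⟨z, hz, hz0⟩ := exists_hasSum_zero_of_weierstrass_degree_pos ht0 htend hN0 hmax hlast
  exact hne z (hz.trans_lt htR) hz0

/-- If the linear coefficient of a power series dominates the later ones on an open disk, then the
power series is a scaled isometry on this disk. -/
lemma norm_sub_eq_of_norm_coeff_mul_pow_le {c : ℕ → K} {f : K → K} {R : ℝ}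
    (hf : ∀ x : K, ‖x‖ < R → HasSum (fun n => c n * x ^ n) (f x))
    (hc : ∀ ρ, 0 < ρ → ρ < R → ∀ n, ‖c (n + 1)‖ * ρ ^ n ≤ ‖c 1‖) {x y : K}
    (hx : ‖x‖ < R) (hy : ‖y‖ < R) : ‖f x - f y‖ = ‖c 1‖ * ‖x - y‖ := by
  rcases eq_or_ne x y with rfl | hxy
  · simp
  set s := max ‖x‖ ‖y‖
  have hs : 0 ≤ s := le_max_of_le_left (norm_nonneg x)
  obtain ⟨ρ, hsρ, hρR⟩ := exists_between (max_lt hx hy)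
  have hρ : 0 < ρ := hs.trans_lt hsρ
  have hsum := (hasSum_nat_add_iff' 2).mpr ((hf x hx).sub (hf y hy))
  have hbound : ‖f x - f y - c 1 * (x - y)‖ ≤ s / ρ * (‖c 1‖ * ‖x - y‖) := by
    have heq : f x - f y - c 1 * (x - y) =
        ∑' n, (c (n + 2) * x ^ (n + 2) - c (n + 2) * y ^ (n + 2)) := by
      rw [hsum.tsum_eq]
      simp [Finset.sum_range_succ, mul_sub]
    rw [heq]
    refine IsUltrametricDist.norm_tsum_le_of_forall_le_of_nonneg (by positivity) fun n => ?_
    rw [← mul_sub, norm_mul]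
    calc _ ≤ ‖c (n + 2)‖ * (s ^ (n + 1) * ‖x - y‖) := by
          gcongr; exact norm_pow_sub_pow_mul_le (le_max_left _ _) (le_max_right _ _) (n + 1)
      _ ≤ ‖c (n + 2)‖ * (s * ρ ^ n * ‖x - y‖) := by
          rw [pow_succ']; gcongr
      _ = s / ρ * ((‖c (n + 1 + 1)‖ * ρ ^ (n + 1)) * ‖x - y‖) := by
          rw [pow_succ]; field_simp
      _ ≤ _ := by gcongr; exact hc ρ hρ hρR (n + 1)
  rcases eq_or_ne (c 1) 0 with h1 | h1
  · simpa [h1] using hbound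
  have hpos : 0 < ‖c 1‖ * ‖x - y‖ :=
    mul_pos (norm_pos_iff.mpr h1) (norm_pos_iff.mpr (sub_ne_zero.mpr hxy))
  have hlt : ‖f x - f y - c 1 * (x - y)‖ < ‖c 1 * (x - y)‖ := by
    rw [norm_mul]
    exact hbound.trans_lt (mul_lt_of_lt_one_left hpos ((div_lt_one hρ).mpr hsρ))
  have := IsUltrametricDist.norm_add_eq_max_of_norm_ne_norm hlt.ne
  rwa [sub_add_cancel, max_eq_right hlt.le, norm_mul] at this

/-- A power series with nonzero linear coefficient that is injective on an open disk is a scaled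
isometry on this disk. -/
lemma norm_sub_eq_of_injOn_of_coeff_one_ne_zero [CompleteSpace K] [IsAlgClosed K]
    {c : ℕ → K} {f : K → K} {R : ℝ}
    (hf : ∀ x : K, ‖x‖ < R → HasSum (fun n => c n * x ^ n) (f x))
    (hinj : Set.InjOn f (Metric.ball 0 R)) (hc : c 1 ≠ 0) {x y : K}
    (hx : ‖x‖ < R) (hy : ‖y‖ < R) : ‖f x - f y‖ = ‖c 1‖ * ‖x - y‖ := by
  have hR : 0 < R := (norm_nonneg x).trans_lt hx
  have hzero : ∀ g : ℕ → K, HasSum (fun n => g n * 0 ^ n) (g 0) := fun g => by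
    simpa using hasSum_single (f := fun n => g n * 0 ^ n) 0 fun n hn => by simp [hn]
  refine norm_sub_eq_of_norm_coeff_mul_pow_le hf (fun ρ hρ hρR => ?_) hx hy
  refine norm_coeff_mul_pow_le_of_forall_not_hasSum_zero (c := fun n => c (n + 1))
    (fun t ht => ?_) (fun t ht h => ?_) hρ hρR
  · rcases eq_or_ne t 0 with rfl | ht0
    · exact (hzero _).summable
    · have := ((summable_nat_add_iff 1).mpr (hf t ht).summable).mul_right t⁻¹
      refine this.congr fun n => ?_
      rw [pow_succ]
      field_simp
  · rcases eq_or_ne t 0 with rfl | ht0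
    · exact hc ((hzero _).unique h)
    · refine ht0 (hinj (by simpa using ht) (by simpa using hR) ?_)
      have h0 : f 0 = c 0 := (hf 0 (by simpa using hR)).unique (hzero c)
      have h1 := (hasSum_nat_add_iff' 1).mpr (hf t ht)
      have h2 : HasSum (fun n => c (n + 1) * t ^ (n + 1)) 0 := by
        simpa [pow_succ, mul_assoc] using h.mul_right t
      have := h1.unique h2
      rw [h0, ← sub_eq_zero]
      simpa using this

end PowerSeries

section Analytic

variable {K : Type*} [NontriviallyNormedField K] [CompleteSpace K] [CharZero K]

/-- An analytic function in characteristic zero whose derivative vanishes near the center is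
constant on its disk of convergence. -/
lemma HasFPowerSeriesOnBall.eq_of_eventually_deriv_eq_zero {f : K → K}
    {p : FormalMultilinearSeries K K K} {z : K} {r : ENNReal} (hf : HasFPowerSeriesOnBall f p z r)
    (hd : ∀ᶠ x in 𝓝 z, deriv f x = 0) {x : K} (hx : x ∈ Metric.eball z r) : f x = f z := by
  have hp : ∀ n ≠ 0, p.coeff n = 0 := by
    rintro (_ | n) hn
    · contradiction
    have h := hf.factorial_smul 1 (n + 1)
    rw [← iteratedDeriv_eq_iteratedFDeriv, iteratedDeriv_succ',
      (show deriv f =ᶠ[𝓝 z] fun _ => 0 from hd).iteratedDeriv_eq] at h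
    rw [iteratedDeriv_const, ite_self, nsmul_eq_mul] at h
    exact (mul_eq_zero.mp h).resolve_left (Nat.cast_ne_zero.mpr (Nat.factorial_ne_zero _))
  have h1 := hf.hasSum_sub hx
  have h2 : HasSum (fun n => p n fun _ => x - z) (p.coeff 0) := by
    simpa using hasSum_single (f := fun n => p n fun _ => x - z) 0 fun n hn => by
      simp [hp n hn]
  rw [h1.unique h2, ← hf.coeff_zero fun _ => 1]
  rfl

/-- Over a complete algebraically closed nonarchimedean field of characteristic zero, an injective
analytic function has nonzero derivative. -/
lemma HasFPowerSeriesOnBall.deriv_ne_zero_of_injOn [IsUltrametricDist K] [IsAlgClosed K]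
    {f : K → K} {p : FormalMultilinearSeries K K K} {R : NNReal}
    (hf : HasFPowerSeriesOnBall f p 0 R) (hinj : Set.InjOn f (Metric.ball 0 R)) :
    deriv f 0 ≠ 0 := by
  intro hd
  have hR : (0 : ℝ) < R := by simpa using hf.r_pos
  obtain ⟨x, hx0, hxR⟩ := NormedField.exists_norm_lt K (half_pos hR)
  have hx0 : x ≠ 0 := norm_pos_iff.mp hx0
  have hne : f x ≠ f 0 := fun h =>
    hx0 (hinj (by simpa using hxR.trans (half_lt_self hR)) (by simpa using hR) h)
  have hfa : AnalyticAt K f 0 := hf.analyticAt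
  rcases hfa.deriv.eventually_eq_zero_or_eventually_ne_zero with h0 | h0
  · refine hne (hf.eq_of_eventually_deriv_eq_zero h0 ?_)
    rw [Metric.eball_coe]
    simpa using hxR.trans (half_lt_self hR)
  have hev : ∀ᶠ y in 𝓝[≠] (0 : K), ‖f x - f y‖ = ‖deriv f y‖ * ‖x - y‖ := by
    filter_upwards [h0, nhdsWithin_le_nhds (Metric.ball_mem_nhds 0 (half_pos hR))] with y hy hyR
    rw [mem_ball_zero_iff] at hyR
    have hyR' : (‖y‖₊ : ENNReal) < R := by
      exact_mod_cast (show ‖y‖ < R from hyR.trans (half_lt_self hR))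
    have hq := hf.changeOrigin hyR'
    rw [zero_add] at hq
    have hcoeff : (p.changeOrigin y).coeff 1 = deriv f y := hq.hasFPowerSeriesAt.deriv.symm
    have hsum : ∀ t : K, ‖t‖ < R / 2 →
        HasSum (fun n => (p.changeOrigin y).coeff n * t ^ n) (f (y + t)) := by
      intro t ht
      have := hq.hasSum (y := t) (by
        rw [mem_eball_zero_iff, lt_tsub_iff_right]
        rw [enorm_eq_nnnorm]
        exact_mod_cast (show ‖t‖ + ‖y‖ < R by linarith))
      simpa [FormalMultilinearSeries.apply_eq_pow_smul_coeff, mul_comm] using this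
    have hinj' : Set.InjOn (fun t => f (y + t)) (Metric.ball 0 (R / 2)) := by
      have hmem : ∀ t ∈ Metric.ball (0 : K) (R / 2), y + t ∈ Metric.ball (0 : K) R := by
        intro t ht
        rw [mem_ball_zero_iff] at ht ⊢
        linarith [norm_add_le y t]
      intro t ht u hu h
      exact add_left_cancel (hinj (hmem t ht) (hmem u hu) h)
    have hxy : ‖x - y‖ < R / 2 := by
      have := IsUltrametricDist.norm_add_le_max x (-y)
      rw [norm_neg, ← sub_eq_add_neg] at this
      exact this.trans_lt (max_lt hxR hyR)
    have := norm_sub_eq_of_injOn_of_coeff_one_ne_zero hsum hinj' (by rwa [hcoeff]) hxy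
      (y := 0) (by simpa using half_pos hR)
    simpa [hcoeff] using this
  have hl : Tendsto (fun y => ‖f x - f y‖) (𝓝[≠] 0) (𝓝 ‖f x - f 0‖) :=
    (hfa.continuousAt.tendsto.const_sub (f x)).norm.mono_left nhdsWithin_le_nhds
  have hr : Tendsto (fun y => ‖deriv f y‖ * ‖x - y‖) (𝓝[≠] 0) (𝓝 (‖deriv f 0‖ * ‖x - 0‖)) :=
    (hfa.deriv.continuousAt.tendsto.norm.mul
      (tendsto_id.const_sub x).norm).mono_left nhdsWithin_le_nhds
  have := tendsto_nhds_unique (hl.congr' hev) hr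
  rw [hd, norm_zero, zero_mul, norm_eq_zero, sub_eq_zero] at this
  exact hne this

/-- Over a complete algebraically closed nonarchimedean field of characteristic zero, a power series
that is injective on the open unit disk has nonzero linear coefficient. -/
lemma coeff_one_ne_zero_of_injOn [IsUltrametricDist K] [IsAlgClosed K] {c : ℕ → K} {f : K → K}
    (hf : ∀ x : K, ‖x‖ < 1 → HasSum (fun n => c n * x ^ n) (f x))
    (hinj : Set.InjOn f (Metric.ball 0 1)) : c 1 ≠ 0 := by
  have hp : HasFPowerSeriesAt f (FormalMultilinearSeries.ofScalars K c) 0 := by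
    rw [hasFPowerSeriesAt_iff]
    filter_upwards [Metric.ball_mem_nhds 0 one_pos] with x hx
    simpa [FormalMultilinearSeries.coeff_ofScalars, mul_comm] using hf x (by simpa using hx)
  obtain ⟨r, hr⟩ := hp
  obtain ⟨R, hR0, hR⟩ := ENNReal.lt_iff_exists_nnreal_btwn.mp (lt_min hr.r_pos one_pos)
  have hR1 : (R : ℝ) < 1 := by exact_mod_cast hR.trans_le (min_le_right _ _)
  have hd := (hr.mono hR0 (hR.le.trans (min_le_left _ _))).deriv_ne_zero_of_injOn
    (hinj.mono (Metric.ball_subset_ball hR1.le))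
  rw [hr.hasFPowerSeriesAt.deriv] at hd
  rwa [← FormalMultilinearSeries.coeff_ofScalars (p := c) (n := 1)]

end Analytic

/-- **Injective implies scaled isometry.** Over a complete algebraically closed
nonarchimedean field of characteristic zero, a power series injective on the open unit
disk is a scaled isometry there, with ratio `‖a₁‖`. -/
theorem stmt_9 {K : Type*} [NormedField K] [IsUltrametricDist K] [CompleteSpace K]
    [CharZero K] [IsAlgClosed K]
    (a : ℕ → K)
    (hconv : ∀ x : K, ‖x‖ < 1 → Summable (fun n : ℕ => a n * x ^ n))
    (f : K → K) (hf : ∀ x : K, f x = ∑' n : ℕ, a n * x ^ n)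
    (hinj : ∀ x y : K, ‖x‖ < 1 → ‖y‖ < 1 → f x = f y → x = y) :
    ∀ x y : K, ‖x‖ < 1 → ‖y‖ < 1 → ‖f x - f y‖ = ‖a 1‖ * ‖x - y‖ := by
  have hsum : ∀ x : K, ‖x‖ < 1 → HasSum (fun n => a n * x ^ n) (f x) := fun x hx => by
    rw [hf x]
    exact (hconv x hx).hasSum
  have hinj' : Set.InjOn f (Metric.ball 0 1) := fun x hx y hy h =>
    hinj x y (by simpa using hx) (by simpa using hy) h
  intro x y hx hy
  rcases eq_or_ne x y with rfl | hxy
  · simp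
  obtain ⟨t, ht0, ht1⟩ : ∃ t : K, t ≠ 0 ∧ ‖t‖ < 1 := by
    by_cases h : x = 0
    · exact ⟨y, fun h' => hxy (h.trans h'.symm), hy⟩
    · exact ⟨x, h, hx⟩
  let : NontriviallyNormedField K := .ofNormNeOne ⟨t, ht0, ht1.ne⟩
  exact norm_sub_eq_of_injOn_of_coeff_one_ne_zero hsum hinj'
    (coeff_one_ne_zero_of_injOn hsum hinj') hx hy
end

section
/- Let K be a complete nonarchimedean normed field that is algebraically closed. Let a : ℕ → K satisfy: a₀ = 0; ‖aᵢ‖ ≤ 1 for all i; and for every real ε > 0 there exists an index i ≥ 1 with ‖aᵢ‖ > 1 − ε. Then for every b ∈ K with ‖b‖ < 1 there exists x ∈ K with ‖x‖ < 1 and Σ'_{i≥0} aᵢ xⁱ = b (the series being summable since ‖aᵢ‖ ≤ 1 and ‖x‖ < 1). -/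
open Polynomial Filter Topology

section GaussNorm

variable {K : Type*} [NormedField K]

theorem gaussNorm_X_sub_C_eq_max (c : ℝ) (hc : 0 < c) (y : K) :
    (X - C y).gaussNorm (NormedField.toAbsoluteValue K) c = max c ‖y‖ := by
  apply le_antisymm
  · obtain ⟨i, hi⟩ := exists_eq_gaussNorm (NormedField.toAbsoluteValue K) c (X - C y)
    rw [hi]
    rcases i with _ | _ | i
    · simp [NormedField.toAbsoluteValue]
    · simp [NormedField.toAbsoluteValue]
    · simp [NormedField.toAbsoluteValue, coeff_X, hc.le]
  · apply max_le
    · refine le_of_eq_of_le ?_ (le_gaussNorm _ _ hc.le 1)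
      simp [NormedField.toAbsoluteValue]
    · refine le_of_eq_of_le ?_ (le_gaussNorm _ _ hc.le 0)
      simp [NormedField.toAbsoluteValue]

theorem Polynomial.Splits.norm_eval_eq_prod_roots {p : K[X]} (hp : p.Splits) (x : K) :
    ‖p.eval x‖ = ‖p.leadingCoeff‖ * (p.roots.map fun y => ‖x - y‖).prod := by
  rw [hp.eval_eq_prod_roots, norm_mul]
  congr 1
  have := map_multiset_prod (normHom : K →*₀ ℝ) (p.roots.map fun y => x - y)
  simpa [Multiset.map_map, Function.comp_def] using this

variable [IsUltrametricDist K]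

theorem IsUltrametricDist.norm_sub_le_max_norm (x y : K) : ‖x - y‖ ≤ max ‖x‖ ‖y‖ := by
  simpa [sub_eq_add_neg] using IsUltrametricDist.norm_add_le_max x (-y)

theorem Polynomial.Splits.gaussNorm_eq_prod_roots {p : K[X]} (hp : p.Splits) {c : ℝ}
    (hc : 0 < c) :
    p.gaussNorm (NormedField.toAbsoluteValue K) c =
      ‖p.leadingCoeff‖ * (p.roots.map fun y => max c ‖y‖).prod := by
  have hna : IsNonarchimedean (NormedField.toAbsoluteValue K) :=
    IsUltrametricDist.isNonarchimedean_norm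
  have hprod (s : Multiset K) :
      (s.map fun y => X - C y).prod.gaussNorm (NormedField.toAbsoluteValue K) c =
        (s.map fun y => max c ‖y‖).prod := by
    induction s using Multiset.induction with
    | empty =>
      simpa using gaussNorm_C (NormedField.toAbsoluteValue K) c (1 : K)
    | cons y s ih =>
      rw [Multiset.map_cons, Multiset.prod_cons, gaussNorm_mul hna hc, ih,
        gaussNorm_X_sub_C_eq_max c hc, Multiset.map_cons, Multiset.prod_cons]
  conv_lhs => rw [hp.eq_prod_roots]
  rw [gaussNorm_mul hna hc, hprod, gaussNorm_C]
  rfl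

/-- A polynomial one of whose higher terms dominates its constant term on the circle of radius `r`
has a root in the open disk of radius `r`. -/
theorem Polynomial.Splits.exists_root_norm_lt {p : K[X]} (hp : p.Splits) {r : ℝ} (hr : 0 < r)
    {N : ℕ} (hN : ‖p.coeff 0‖ < ‖p.coeff N‖ * r ^ N) :
    ∃ y ∈ p.roots, ‖y‖ < r := by
  by_contra! h
  have h1 := le_gaussNorm (NormedField.toAbsoluteValue K) p hr.le N
  rw [hp.gaussNorm_eq_prod_roots hr] at h1
  have h2 := hp.norm_eval_eq_prod_roots 0
  rw [← coeff_zero_eq_eval_zero] at h2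
  rw [Multiset.map_congr rfl (fun y hy => max_eq_right (h y hy))] at h1
  simp only [zero_sub, norm_neg] at h2
  rw [← h2] at h1
  exact absurd hN (not_lt.mpr h1)

/-- For polynomials with integral coefficients and constant term of fixed norm, a point of a disk
of radius `r < 1` at distance at least `δ` from all roots has a value bounded away from zero. -/
theorem Polynomial.Splits.pow_norm_coeff_zero_le_norm_eval {p : K[X]} (hp : p.Splits)
    (hbd : ∀ i, ‖p.coeff i‖ ≤ 1) {r δ : ℝ} {D : ℕ} (hr1 : r < 1) (hD : r ^ D ≤ δ)
    {x : K} (hx : ‖x‖ ≤ r) (hroots : ∀ y ∈ p.roots, δ ≤ ‖x - y‖) :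
    ‖p.coeff 0‖ ^ (D + 1) ≤ ‖p.eval x‖ := by
  have hfac : ∀ y ∈ p.roots, ‖y‖ ^ (D + 1) ≤ ‖x - y‖ * max 1 ‖y‖ ^ D := by
    intro y hy
    rcases le_or_gt ‖y‖ r with hyr | hyr
    · calc ‖y‖ ^ (D + 1) ≤ ‖y‖ ^ D :=
            pow_le_pow_of_le_one (norm_nonneg _) (hyr.trans hr1.le) D.le_succ
        _ ≤ r ^ D := by gcongr
        _ ≤ ‖x - y‖ := hD.trans (hroots y hy)
        _ ≤ ‖x - y‖ * max 1 ‖y‖ ^ D :=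
            le_mul_of_one_le_right (norm_nonneg _) (one_le_pow₀ (le_max_left _ _))
    · have hxy : ‖y‖ ≤ ‖x - y‖ := by
        have h := IsUltrametricDist.norm_sub_le_max_norm x (x - y)
        rw [sub_sub_cancel] at h
        exact (le_max_iff.mp h).resolve_left (not_le.mpr (hx.trans_lt hyr))
      rw [pow_succ']
      gcongr
      exact le_max_right _ _
  have hG : p.gaussNorm (NormedField.toAbsoluteValue K) 1 ≤ 1 := by
    obtain ⟨i, hi⟩ := exists_eq_gaussNorm (NormedField.toAbsoluteValue K) 1 p
    rw [hi, one_pow, mul_one]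
    exact hbd i
  have h0 := hp.norm_eval_eq_prod_roots 0
  simp only [← coeff_zero_eq_eval_zero, zero_sub, norm_neg] at h0
  have hprod : (p.roots.map fun y => ‖y‖ ^ (D + 1)).prod ≤
      (p.roots.map fun y => ‖x - y‖ * max 1 ‖y‖ ^ D).prod :=
    Multiset.prod_map_le_prod_map₀ _ _ (fun y _ => by positivity) hfac
  rw [Multiset.prod_map_mul, Multiset.prod_map_pow, Multiset.prod_map_pow] at hprod
  calc ‖p.coeff 0‖ ^ (D + 1)
      = ‖p.leadingCoeff‖ ^ (D + 1) * (p.roots.map fun y => ‖y‖).prod ^ (D + 1) := by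
        rw [h0, mul_pow]
    _ ≤ ‖p.leadingCoeff‖ ^ (D + 1) * ((p.roots.map fun y => ‖x - y‖).prod *
          (p.roots.map fun y => max 1 ‖y‖).prod ^ D) := by gcongr
    _ = ‖p.eval x‖ * p.gaussNorm (NormedField.toAbsoluteValue K) 1 ^ D := by
        rw [hp.norm_eval_eq_prod_roots x, hp.gaussNorm_eq_prod_roots one_pos]
        ring
    _ ≤ ‖p.eval x‖ :=
        mul_le_of_le_one_right (norm_nonneg _)
          (pow_le_one₀ (gaussNorm_nonneg _ _ zero_le_one) hG)

theorem norm_pow_sub_pow_le_of_norm_le_one {x y : K} (hx : ‖x‖ ≤ 1) (hy : ‖y‖ ≤ 1) (n : ℕ) :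
    ‖x ^ n - y ^ n‖ ≤ ‖x - y‖ := by
  induction n with
  | zero => simp
  | succ n ih =>
    have h : x ^ (n + 1) - y ^ (n + 1) = x ^ n * (x - y) + (x ^ n - y ^ n) * y := by ring
    rw [h]
    refine (IsUltrametricDist.norm_add_le_max _ _).trans (max_le ?_ ?_)
    · rw [norm_mul, norm_pow]
      exact mul_le_of_le_one_left (norm_nonneg _) (pow_le_one₀ (norm_nonneg _) hx)
    · rw [norm_mul]
      exact (mul_le_of_le_one_right (norm_nonneg _) hy).trans ih

/-- If all coefficients are integral and some term of positive degree dominates the constant term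
on the circle of radius `r < 1`, then the power series has a zero in the closed disk of radius
`r`. -/
theorem exists_norm_le_tendsto_sum_zero [CompleteSpace K] [IsAlgClosed K] {c : ℕ → K}
    (hbd : ∀ i, ‖c i‖ ≤ 1) (hc0 : c 0 ≠ 0) {r : ℝ} (hr : 0 < r) (hr1 : r < 1) {N : ℕ}
    (hN : ‖c 0‖ < ‖c N‖ * r ^ N) :
    ∃ x : K, ‖x‖ ≤ r ∧ Tendsto (fun n => ∑ i ∈ Finset.range n, c i * x ^ i) atTop (𝓝 0) := by
  classical
  set P : ℕ → K[X] := fun n => ∑ i ∈ Finset.range n, monomial i (c i) with hP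
  have hcoeff (n j : ℕ) : (P n).coeff j = if j < n then c j else 0 := by
    simp [hP, coeff_monomial]
  have heval (n : ℕ) (x : K) : (P n).eval x = ∑ i ∈ Finset.range n, c i * x ^ i := by
    simp [hP, eval_finsetSum]
  have hPbd (n i : ℕ) : ‖(P n).coeff i‖ ≤ 1 := by
    rw [hcoeff]
    split_ifs
    exacts [hbd i, by simp]
  have hstep (n : ℕ) (x : K) (hx : ‖x‖ ≤ r) : ∃ y ∈ (P (N + 1 + n)).roots, ‖y‖ ≤ r ∧
      ∀ z ∈ (P (N + 1 + n)).roots, ‖x - y‖ ≤ ‖x - z‖ := by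
    obtain ⟨w, hw, hwr⟩ := (IsAlgClosed.splits (P (N + 1 + n))).exists_root_norm_lt hr (N := N)
      (by rwa [hcoeff, hcoeff, if_pos (by omega), if_pos (by omega)])
    obtain ⟨y, hy, hmin⟩ := (P (N + 1 + n)).roots.toFinset.exists_min_image (fun z => ‖x - z‖)
      ⟨w, Multiset.mem_toFinset.mpr hw⟩
    simp only [Multiset.mem_toFinset] at hy hmin
    refine ⟨y, hy, ?_, hmin⟩
    have hxy : ‖x - y‖ ≤ r := (hmin w hw).trans
      ((IsUltrametricDist.norm_sub_le_max_norm x w).trans (max_le hx hwr.le))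
    have h := IsUltrametricDist.norm_sub_le_max_norm x (x - y)
    rw [sub_sub_cancel] at h
    exact h.trans (max_le hx hxy)
  choose! g hgroot hgr hgmin using hstep
  let u : ℕ → K := fun n => Nat.rec 0 (fun n x => g n x) n
  have hu (n : ℕ) : u (n + 1) = g n (u n) := rfl
  have hur (n : ℕ) : ‖u n‖ ≤ r := by
    induction n with
    | zero => simpa [u] using hr.le
    | succ n ih => exact hgr n _ ih
  have huroot (n : ℕ) : (P (N + 1 + n)).eval (u (n + 1)) = 0 :=
    (mem_roots'.mp (hgroot n _ (hur n))).2
  have hsmall (n : ℕ) : ‖(P (N + 1 + (n + 1))).eval (u (n + 1))‖ ≤ r ^ n := by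
    have h := huroot n
    rw [heval] at h
    rw [heval, ← add_assoc, Finset.sum_range_succ, h, zero_add, norm_mul, norm_pow]
    calc ‖c (N + 1 + n)‖ * ‖u (n + 1)‖ ^ (N + 1 + n) ≤ 1 * r ^ (N + 1 + n) := by
          gcongr
          exacts [hbd _, hur (n + 1)]
      _ ≤ r ^ n := by
          rw [one_mul]
          exact pow_le_pow_of_le_one hr.le hr1.le (by omega)
  have hdiff : Tendsto (fun n => u (n + 1) - u n) atTop (𝓝 0) := by
    rw [← tendsto_add_atTop_iff_nat 1]
    refine NormedAddGroup.tendsto_nhds_zero.mpr fun δ hδ => ?_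
    obtain ⟨D, hD⟩ := exists_pow_lt_of_lt_one hδ hr1
    have hη : 0 < ‖c 0‖ ^ (D + 1) := pow_pos (norm_pos_iff.mpr hc0) _
    filter_upwards [(tendsto_pow_atTop_nhds_zero_of_lt_one hr.le hr1).eventually_lt_const hη]
      with n hn
    by_contra! hle
    rw [norm_sub_rev] at hle
    have h := (IsAlgClosed.splits (P (N + 1 + (n + 1)))).pow_norm_coeff_zero_le_norm_eval
      (hPbd _) hr1 hD.le (hur (n + 1))
      (fun z hz => hle.trans (hgmin (n + 1) _ (hur (n + 1)) z hz))
    rw [hcoeff, if_pos (by omega)] at h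
    exact absurd (h.trans (hsmall n)) (not_le.mpr hn)
  obtain ⟨x, hx⟩ := cauchySeq_tendsto_of_complete
    (NonarchimedeanAddGroup.cauchySeq_of_tendsto_sub_nhds_zero hdiff)
  have hxr : ‖x‖ ≤ r := le_of_tendsto hx.norm (Eventually.of_forall hur)
  refine ⟨x, hxr, ?_⟩
  rw [← tendsto_add_atTop_iff_nat (N + 1)]
  have hlim : Tendsto (fun n => ‖x - u (n + 1)‖) atTop (𝓝 0) := by
    simpa using ((tendsto_const_nhds (x := x)).sub ((tendsto_add_atTop_iff_nat 1).mpr hx)).norm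
  refine squeeze_zero_norm (fun n => ?_) hlim
  have h := huroot n
  rw [heval] at h
  rw [add_comm n (N + 1), ← sub_zero (∑ i ∈ Finset.range (N + 1 + n), c i * x ^ i), ← h,
    ← Finset.sum_sub_distrib]
  refine IsUltrametricDist.norm_sum_le_of_forall_le_of_nonneg (norm_nonneg _) fun i _ => ?_
  rw [← mul_sub, norm_mul]
  exact (mul_le_of_le_one_left (norm_nonneg _) (hbd i)).trans
    (norm_pow_sub_pow_le_of_norm_le_one (hxr.trans hr1.le) ((hur (n + 1)).trans hr1.le) i)

end GaussNorm

/-- **Remark 0.5 (surjectivity via Newton polygons).** A power series with `a₀ = 0`,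
`‖aᵢ‖ ≤ 1`, and `sup_{i ≥ 1} ‖aᵢ‖ = 1` maps the open unit disk of a complete
algebraically closed nonarchimedean field onto the open unit disk. -/
theorem stmt_10 {K : Type*} [NormedField K] [IsUltrametricDist K] [CompleteSpace K]
    [IsAlgClosed K]
    (a : ℕ → K) (ha0 : a 0 = 0) (hbd : ∀ i : ℕ, ‖a i‖ ≤ 1)
    (hsup : ∀ ε : ℝ, 0 < ε → ∃ i : ℕ, 1 ≤ i ∧ ‖a i‖ > 1 - ε) :
    ∀ b : K, ‖b‖ < 1 → ∃ x : K, ‖x‖ < 1 ∧ (∑' i : ℕ, a i * x ^ i) = b := by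
  intro b hb
  rcases eq_or_ne b 0 with rfl | hb0
  · refine ⟨0, by simp, ?_⟩
    rw [tsum_eq_single 0 fun i hi => by simp [hi]]
    simp [ha0]
  obtain ⟨N, hN1, hN⟩ := hsup (1 - ‖b‖) (by linarith)
  rw [sub_sub_cancel] at hN
  obtain ⟨r, hNr, hr, hr1⟩ : ∃ r : ℝ, ‖b‖ < ‖a N‖ * r ^ N ∧ r ∈ Set.Ioo 0 1 := by
    have hlim : Tendsto (fun r : ℝ => ‖a N‖ * r ^ N) (𝓝[<] 1) (𝓝 (‖a N‖ * 1 ^ N)) :=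
      (Continuous.tendsto (by fun_prop) _).mono_left nhdsWithin_le_nhds
    rw [one_pow, mul_one] at hlim
    exact ((hlim.eventually_const_lt hN).and (Ioo_mem_nhdsLT zero_lt_one)).exists
  have hN0 : N ≠ 0 := by omega
  obtain ⟨x, hxr, hx⟩ := exists_norm_le_tendsto_sum_zero (c := Function.update a 0 (-b))
    (fun i => by
      rcases eq_or_ne i 0 with rfl | hi
      · simpa using hb.le
      · simpa [hi] using hbd i)
    (by simpa using hb0) hr hr1 (N := N) (by simpa [hN0] using hNr)
  have hx1 : ‖x‖ < 1 := hxr.trans_lt hr1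
  refine ⟨x, hx1, ?_⟩
  have hsum : Summable fun i => a i * x ^ i := by
    refine Summable.of_norm_bounded (summable_geometric_of_lt_one (norm_nonneg x) hx1) fun i => ?_
    rw [norm_mul, norm_pow]
    exact mul_le_of_le_one_left (by positivity) (hbd i)
  refine tendsto_nhds_unique
    ((tendsto_add_atTop_iff_nat 1).mpr hsum.hasSum.tendsto_sum_nat) ?_
  have hx' := ((tendsto_add_atTop_iff_nat 1).mpr hx).add_const b
  simpa [Finset.sum_range_succ', ha0] using hx'
end

section
/- Let R be a commutative ring equipped with a derivation ∂ : R → R (a ℤ-linear map satisfying the Leibniz rule). Let d be a natural number, let A = (Fin d → R) be the product ring with pointwise operations, viewed as an R-algebra via the diagonal map C : R → A, and let D : A → A be a derivation (ℤ-linear, Leibniz) satisfying D(C(r)) = C(∂(r)) for all r ∈ R. Then every R-algebra homomorphism σ : A → R is horizontal: σ(D(a)) = ∂(σ(a)) for all a ∈ A. -/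
/-- A map satisfying the Leibniz rule kills idempotents. -/
theorem leibniz_map_eq_zero_of_isIdempotentElem {S : Type*} [CommRing S] {f : S → S}
    (hf : ∀ x y : S, f (x * y) = x * f y + f x * y) {e : S} (he : IsIdempotentElem e) :
    f e = 0 := by
  have h : f e = e * f e + f e * e := by rw [← hf, he.eq]
  linear_combination (1 - 2 * e) * h - 4 * f e * he.eq

/-- **Lemma 1.5, algebraic core ("sections are solutions").** If `A = Fin d → R` is the
product ring viewed as an `R`-algebra via the diagonal, `δ` is a derivation of `R`, and
`D` is a derivation of `A` lifting `δ` on constants, then every `R`-algebra homomorphism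
`σ : A → R` is horizontal: `σ(D a) = δ(σ a)`. -/
theorem stmt_11 {R : Type*} [CommRing R] (δ : R → R)
    (hδadd : ∀ x y : R, δ (x + y) = δ x + δ y)
    (hδmul : ∀ x y : R, δ (x * y) = x * δ y + δ x * y)
    (d : ℕ) (D : (Fin d → R) → (Fin d → R))
    (hDadd : ∀ x y : Fin d → R, D (x + y) = D x + D y)
    (hDmul : ∀ x y : Fin d → R, D (x * y) = x * D y + D x * y)
    (hDC : ∀ r : R, D (fun _ => r) = fun _ => δ r)
    (σ : (Fin d → R) →+* R) (hσ : ∀ r : R, σ (fun _ => r) = r)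
    (v : Fin d → R) : σ (D v) = δ (σ v) := by
  have hsingle (i : Fin d) (r : R) : σ (D (Pi.single i r)) = δ (σ (Pi.single i r)) := by
    have he : IsIdempotentElem (Pi.single i 1 : Fin d → R) := by
      rw [IsIdempotentElem, ← Pi.single_mul, one_mul]
    have hr : (Pi.single i r : Fin d → R) = (fun _ => r) * Pi.single i 1 := by
      ext j
      by_cases h : j = i <;> simp [h]
    rw [hr, hDmul, map_mul, hσ, hδmul, hDC, leibniz_map_eq_zero_of_isIdempotentElem hDmul he,
      leibniz_map_eq_zero_of_isIdempotentElem hδmul (he.map σ), mul_zero, mul_zero, zero_add,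
      zero_add, map_mul, hσ]
  have hext : σ.toAddMonoidHom.comp (AddMonoidHom.mk' D hDadd) =
      (AddMonoidHom.mk' δ hδadd).comp σ.toAddMonoidHom :=
    AddMonoidHom.functions_ext _ _ _ hsingle
  exact DFunLike.congr_fun hext v
end

section
/- Let K be a nonarchimedean normed field and p a prime with ‖(p : K)‖ = (p : ℝ)⁻¹. Then for every integer n ≥ 1 one has ‖(n : K)‖ ≥ ((p : ℝ)^{-1/(p-1)})^{n-1}, where the outer exponentiation is by the natural number n − 1 and (p : ℝ)^{-1/(p-1)} uses the real power function. -/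
/-- In an ultrametric normed field, an integer prime to a natural number of norm less than one
has norm at least one. -/
theorem one_le_norm_natCast_of_coprime {K : Type*} [NormedField K] [IsUltrametricDist K]
    {p n : ℕ} (hpK : ‖(p : K)‖ < 1) (h : Nat.Coprime n p) : 1 ≤ ‖(n : K)‖ := by
  obtain ⟨a, b, hab⟩ := Nat.isCoprime_iff_coprime.mpr h
  have hK : (a : K) * n + b * p = 1 := by exact_mod_cast congrArg (Int.cast : ℤ → K) hab
  have ha : ‖(a : K)‖ ≤ 1 := IsUltrametricDist.norm_intCast_le_one K a
  have hb : ‖(b : K)‖ ≤ 1 := IsUltrametricDist.norm_intCast_le_one K b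
  have hmax := IsUltrametricDist.norm_add_le_max ((a : K) * n) (b * p)
  rw [hK, norm_one, norm_mul, norm_mul, le_max_iff] at hmax
  rcases hmax with h1 | h1
  · exact h1.trans (mul_le_of_le_one_left (norm_nonneg _) ha)
  · exact absurd (h1.trans (mul_le_of_le_one_left (norm_nonneg _) hb)) (not_le.mpr hpK)

/-- **The decisive estimate.** In a nonarchimedean normed field with `‖p‖ = p⁻¹`, for
every integer `n ≥ 1` one has `‖n‖ ≥ (p^(-1/(p-1)))^(n-1)`. -/
theorem stmt_15 {K : Type*} [NormedField K] [IsUltrametricDist K]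
    (p : ℕ) (hp : p.Prime) (hpK : ‖(p : K)‖ = (p : ℝ)⁻¹) :
    ∀ n : ℕ, 1 ≤ n → ((p : ℝ) ^ (-1 / ((p : ℝ) - 1))) ^ (n - 1) ≤ ‖(n : K)‖ := by
  have hp1 : (1 : ℝ) < p := by exact_mod_cast hp.one_lt
  have hp0 : (0 : ℝ) < p := zero_lt_one.trans hp1
  set r : ℝ := (p : ℝ) ^ (-1 / ((p : ℝ) - 1)) with hr
  have hr0 : 0 ≤ r := Real.rpow_nonneg hp0.le _
  have hr1 : r ≤ 1 := Real.rpow_le_one_of_one_le_of_nonpos hp1.le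
    (div_nonpos_of_nonpos_of_nonneg (by norm_num) (by linarith))
  have hrp : r ^ (p - 1) = (p : ℝ)⁻¹ := by
    rw [hr, ← Real.rpow_natCast, ← Real.rpow_mul hp0.le, Nat.cast_sub hp.one_le, Nat.cast_one,
      div_mul_cancel₀ _ (by linarith), Real.rpow_neg_one]
  intro n
  induction n using Nat.strong_induction_on with
  | _ n ih =>
    intro hn
    by_cases hdvd : p ∣ n
    · obtain ⟨m, rfl⟩ := hdvd
      have hm : 1 ≤ m := Nat.pos_of_mul_pos_left hn
      have hexp : (p - 1) + (m - 1) ≤ p * m - 1 := by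
        obtain ⟨q, rfl⟩ := Nat.exists_eq_add_of_le' hp.one_le
        obtain ⟨k, rfl⟩ := Nat.exists_eq_add_of_le' hm
        have : (q + 1) * (k + 1) = q * k + q + k + 1 := by ring
        simp only [this, Nat.add_sub_cancel]
        omega
      calc r ^ (p * m - 1) ≤ r ^ ((p - 1) + (m - 1)) := pow_le_pow_of_le_one hr0 hr1 hexp
        _ = (p : ℝ)⁻¹ * r ^ (m - 1) := by rw [pow_add, hrp]
        _ ≤ (p : ℝ)⁻¹ * ‖(m : K)‖ :=
          mul_le_mul_of_nonneg_left (ih m (lt_mul_of_one_lt_left hm hp.one_lt) hm)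
            (inv_nonneg.mpr hp0.le)
        _ = ‖((p * m : ℕ) : K)‖ := by rw [Nat.cast_mul, norm_mul, hpK]
    · have hlt : ‖(p : K)‖ < 1 := hpK ▸ inv_lt_one_of_one_lt₀ hp1
      exact (pow_le_one₀ hr0 hr1).trans
        (one_le_norm_natCast_of_coprime hlt ((hp.coprime_iff_not_dvd.mpr hdvd).symm))
end
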